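/- arXiv:1511.03927 — 2 statements merged into one kernel-verified Lean document; each statement's English description precedes it below -/
import Mathlib

section
/- Let n be a positive integer and a, b ≥ 1 with d := a + b ≤ n. Let G be drawn from the stochastic block model G_{2n, a/n, b/n} with degrees d_1,…,d_{2n}. Then the probability that the sum over all vertices j of (d − d_j)² exceeds 4·d·n is at most 21/n. -/
open MeasureTheory

/-- The Bernoulli measure on `Bool` with parameter `p`. -/
noncomputable def bern (p : ℝ) : Measure Bool :=
  p.toNNReal • Measure.dirac true + (1 - p).toNNReal • Measure.dirac false

/-- The stochastic block model `G_{2n,p,q}`: a symmetric random graph on `2n` vertices,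
encoded by independent Bernoulli edge indicators `ω i j` (only the coordinates with
`i ≤ j` are used by `adjOf`), where the pair `{i,j}` (self-loop pairs included) is an
edge with probability `p` if `i,j` are in the same community (`V₁ = {i | i < n}`,
`V₂ = {i | n ≤ i}`) and with probability `q` otherwise. -/
noncomputable def sbm (n : ℕ) (p q : ℝ) :
    Measure (Fin (2 * n) → Fin (2 * n) → Bool) :=
  Measure.pi fun i => Measure.pi fun j =>
    bern (if i.val < n ↔ j.val < n then p else q)

/-- The (symmetric, 0/1) adjacency matrix determined by the edge indicators `ω`. -/
noncomputable def adjOf {m : ℕ} (ω : Fin m → Fin m → Bool) : Matrix (Fin m) (Fin m) ℝ :=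
  Matrix.of fun i j => if i ≤ j then (if ω i j then 1 else 0) else (if ω j i then 1 else 0)

/-- The degree of vertex `i`. -/
noncomputable def deg {m : ℕ} (ω : Fin m → Fin m → Bool) (i : Fin m) : ℝ :=
  ∑ j, adjOf ω i j

/-- The spectral norm (ℓ²-operator norm) of a square real matrix. -/
noncomputable def specNorm {m : ℕ} (M : Matrix (Fin m) (Fin m) ℝ) : ℝ :=
  ‖Matrix.toEuclideanCLM (𝕜 := ℝ) M‖

/-- The expectation matrix `B = 𝔼[A]`: entries `a/n` within communities, `b/n` across. -/
noncomputable def Bmat (n : ℕ) (a b : ℝ) : Matrix (Fin (2*n)) (Fin (2*n)) ℝ :=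
  Matrix.of fun i j => if i.val < n ↔ j.val < n then a / n else b / n

open ProbabilityTheory

section QuadraticForm

variable {Ω ι : Type*} [MeasurableSpace Ω] {μ : Measure Ω} {X : ι → Ω → ℝ}

/-- A finite linear combination of independent centered variables has mean zero. -/
lemma integral_linearForm_eq_zero [Finite Ω] [MeasurableSingletonClass Ω] [IsProbabilityMeasure μ]
    (hX0 : ∀ e, ∫ ω, X e ω ∂μ = 0) (w : ι → ℝ) (s : Finset ι) :
    ∫ ω, ∑ e ∈ s, w e * X e ω ∂μ = 0 := by
  rw [integral_finsetSum _ fun _ _ => Integrable.of_finite]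
  simp [integral_const_mul, hX0]

/-- The values taken by `X g` are independent of any quadratic and linear form in the
variables indexed by a finite set not containing `g`. -/
lemma indepFun_quadraticForm_linearForm (hind : iIndepFun X μ) (hX : ∀ e, Measurable (X e))
    (c : ι → ι → ℝ) (w : ι → ℝ) (m : ℝ) {s : Finset ι} {g : ι} (hg : g ∉ s) :
    IndepFun (X g) (fun ω => ((∑ e ∈ s, ∑ f ∈ s, c e f * (X e ω * X f ω)) - m,
      ∑ e ∈ s, w e * X e ω)) μ := by
  have h := hind.indepFun_finset {g} s (by simpa using hg) hX
  have hφ : Measurable fun x : ({g} : Finset ι) → ℝ => x ⟨g, Finset.mem_singleton_self g⟩ := by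
    fun_prop
  have hψ : Measurable fun x : s → ℝ =>
      ((∑ e : s, ∑ f : s, c e f * (x e * x f)) - m, ∑ e : s, w e * x e) := by
    fun_prop
  refine IndepFun.congr (h.comp hφ hψ) .rfl (.of_forall fun ω => ?_)
  simp only [Function.comp]
  rw [Finset.sum_coe_sort s (fun e => w e * X e ω)]
  congr 2
  rw [← Finset.sum_coe_sort s]
  exact Finset.sum_congr rfl fun e _ =>
    Finset.sum_coe_sort s (fun f => c e f * (X e ω * X f ω))

variable [Finite Ω] [MeasurableSingletonClass Ω] [IsProbabilityMeasure μ]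

lemma integral_linearForm_sq (hind : iIndepFun X μ) (hX0 : ∀ e, ∫ ω, X e ω ∂μ = 0)
    (w : ι → ℝ) (s : Finset ι) :
    ∫ ω, (∑ e ∈ s, w e * X e ω) ^ 2 ∂μ = ∑ e ∈ s, w e ^ 2 * ∫ ω, X e ω ^ 2 ∂μ := by
  classical
  induction s using Finset.induction_on with
  | empty => simp
  | insert g s hg ih =>
    have hI := indepFun_quadraticForm_linearForm hind (fun _ => measurable_of_finite _)
      (fun _ _ => 0) w 0 hg
    have hXL : ∫ ω, X g ω * ∑ e ∈ s, w e * X e ω ∂μ = 0 := by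
      have := (hI.comp measurable_id measurable_snd).integral_fun_mul_eq_mul_integral
        (measurable_of_finite _).aestronglyMeasurable (measurable_of_finite _).aestronglyMeasurable
      simpa [hX0] using this
    have hexp : ∀ ω, (∑ e ∈ insert g s, w e * X e ω) ^ 2
        = w g ^ 2 * X g ω ^ 2 + 2 * w g * (X g ω * ∑ e ∈ s, w e * X e ω)
          + (∑ e ∈ s, w e * X e ω) ^ 2 := by
      intro ω
      rw [Finset.sum_insert hg]
      ring
    simp_rw [hexp]
    rw [integral_add .of_finite .of_finite, integral_add .of_finite .of_finite,
      integral_const_mul, integral_const_mul, hXL, ih, Finset.sum_insert hg]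
    ring

/-- Variance bound for a quadratic form in independent centered variables bounded by `1`. -/
lemma integral_quadraticForm_sub_sq_le (hind : iIndepFun X μ) (hX0 : ∀ e, ∫ ω, X e ω ∂μ = 0)
    (hX1 : ∀ e ω, |X e ω| ≤ 1) (c : ι → ι → ℝ) (hc : ∀ e f, c e f = c f e) (s : Finset ι) :
    ∫ ω, ((∑ e ∈ s, ∑ f ∈ s, c e f * (X e ω * X f ω))
        - ∑ e ∈ s, c e e * ∫ ω, X e ω ^ 2 ∂μ) ^ 2 ∂μ
      ≤ ∑ e ∈ s, c e e ^ 2 * ∫ ω, X e ω ^ 2 ∂μ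
        + 2 * ∑ e ∈ s, ∑ f ∈ s,
          c e f ^ 2 * ((∫ ω, X e ω ^ 2 ∂μ) * ∫ ω, X f ω ^ 2 ∂μ) := by
  classical
  have hv : ∀ e, 0 ≤ ∫ ω, X e ω ^ 2 ∂μ := fun e => integral_nonneg fun ω => sq_nonneg _
  induction s using Finset.induction_on with
  | empty => simp
  | insert g s hg ih =>
    have hI := indepFun_quadraticForm_linearForm hind (fun _ => measurable_of_finite _)
      c (c g) (∑ e ∈ s, c e e * ∫ ω, X e ω ^ 2 ∂μ) hg
    have hL0 := integral_linearForm_eq_zero hX0 (c g) s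
    have hL2 := integral_linearForm_sq hind hX0 (c g) s
    have hexp : ∀ ω, (∑ e ∈ insert g s, ∑ f ∈ insert g s, c e f * (X e ω * X f ω))
        = (∑ e ∈ s, ∑ f ∈ s, c e f * (X e ω * X f ω))
          + 2 * X g ω * (∑ e ∈ s, c g e * X e ω) + c g g * X g ω ^ 2 := by
      intro ω
      have h1 : ∑ e ∈ s, c e g * (X e ω * X g ω) = X g ω * ∑ e ∈ s, c g e * X e ω := by
        rw [Finset.mul_sum]
        exact Finset.sum_congr rfl fun e _ => by rw [hc e g]; ring
      have h2 : ∑ f ∈ s, c g f * (X g ω * X f ω) = X g ω * ∑ e ∈ s, c g e * X e ω := by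
        rw [Finset.mul_sum]
        exact Finset.sum_congr rfl fun e _ => by ring
      simp only [Finset.sum_insert hg, Finset.sum_add_distrib, h1, h2]
      ring
    set v : ι → ℝ := fun e => ∫ ω, X e ω ^ 2 ∂μ with hv_def
    set Z : Ω → ℝ := fun ω => (∑ e ∈ s, ∑ f ∈ s, c e f * (X e ω * X f ω))
      - ∑ e ∈ s, c e e * v e with hZ
    set L : Ω → ℝ := fun ω => ∑ e ∈ s, c g e * X e ω with hL
    have hfac : ∀ (φ : ℝ → ℝ) (ψ : ℝ × ℝ → ℝ), Measurable φ → Measurable ψ →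
        ∫ ω, φ (X g ω) * ψ (Z ω, L ω) ∂μ
          = (∫ ω, φ (X g ω) ∂μ) * ∫ ω, ψ (Z ω, L ω) ∂μ := fun φ ψ hφ hψ =>
      (hI.comp hφ hψ).integral_fun_mul_eq_mul_integral
        (measurable_of_finite _).aestronglyMeasurable (measurable_of_finite _).aestronglyMeasurable
    have hXXLL : ∫ ω, X g ω ^ 2 * L ω ^ 2 ∂μ = v g * ∫ ω, L ω ^ 2 ∂μ :=
      hfac (fun x => x ^ 2) (fun y => y.2 ^ 2) (by fun_prop) (by fun_prop)
    have hXZL : ∫ ω, X g ω * (Z ω * L ω) ∂μ = 0 := by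
      have := hfac (fun x => x) (fun y => y.1 * y.2) (by fun_prop) (by fun_prop)
      simpa [hX0] using this
    have hcenter : ∫ ω, (X g ω ^ 2 - v g) ∂μ = 0 := by
      rw [integral_sub .of_finite .of_finite]
      simp [hv_def]
    have hXZ : ∫ ω, (X g ω ^ 2 - v g) * Z ω ∂μ = 0 := by
      have := hfac (fun x => x ^ 2 - v g) (fun y => y.1) (by fun_prop) (by fun_prop)
      simpa [hcenter] using this
    have hXL : ∫ ω, X g ω * (X g ω ^ 2 - v g) * L ω ∂μ = 0 := by
      have := hfac (fun x => x * (x ^ 2 - v g)) (fun y => y.2) (by fun_prop) (by fun_prop)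
      simpa [hL0] using this
    have hfour : ∫ ω, (X g ω ^ 2 - v g) ^ 2 ∂μ ≤ v g := by
      have h1 : ∀ ω, (X g ω ^ 2 - v g) ^ 2 ≤ X g ω ^ 2 - 2 * v g * (X g ω ^ 2 - v g) := by
        intro ω
        have : X g ω ^ 2 ≤ 1 := (sq_le_one_iff_abs_le_one _).2 (hX1 g ω)
        nlinarith [sq_nonneg (X g ω), sq_nonneg (v g), 
          mul_nonneg (sq_nonneg (X g ω)) (sub_nonneg.2 this)]
      calc ∫ ω, (X g ω ^ 2 - v g) ^ 2 ∂μ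
          ≤ ∫ ω, (X g ω ^ 2 - 2 * v g * (X g ω ^ 2 - v g)) ∂μ :=
            integral_mono .of_finite .of_finite h1
        _ = v g := by
          rw [integral_sub .of_finite .of_finite, integral_const_mul, hcenter]
          simp [hv_def]
    have hsq : ∀ ω, ((∑ e ∈ insert g s, ∑ f ∈ insert g s, c e f * (X e ω * X f ω))
        - ∑ e ∈ insert g s, c e e * v e) ^ 2
        = Z ω ^ 2 + 4 * (X g ω ^ 2 * L ω ^ 2) + c g g ^ 2 * (X g ω ^ 2 - v g) ^ 2
          + 4 * (X g ω * (Z ω * L ω)) + 2 * c g g * ((X g ω ^ 2 - v g) * Z ω)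
          + 4 * c g g * (X g ω * (X g ω ^ 2 - v g) * L ω) := by
      intro ω
      rw [hexp, Finset.sum_insert hg]
      simp only [hZ, hL]
      ring
    have hsum : ∑ e ∈ insert g s, ∑ f ∈ insert g s, c e f ^ 2 * (v e * v f)
        = (∑ e ∈ s, ∑ f ∈ s, c e f ^ 2 * (v e * v f))
          + 2 * (v g * ∑ e ∈ s, c g e ^ 2 * v e) + c g g ^ 2 * (v g * v g) := by
      have h1 : ∑ e ∈ s, c e g ^ 2 * (v e * v g) = v g * ∑ e ∈ s, c g e ^ 2 * v e := by
        rw [Finset.mul_sum]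
        exact Finset.sum_congr rfl fun e _ => by rw [hc e g]; ring
      have h2 : ∑ f ∈ s, c g f ^ 2 * (v g * v f) = v g * ∑ e ∈ s, c g e ^ 2 * v e := by
        rw [Finset.mul_sum]
        exact Finset.sum_congr rfl fun e _ => by ring
      simp only [Finset.sum_insert hg, Finset.sum_add_distrib, h1, h2]
      ring
    change ∫ ω, ((∑ e ∈ insert g s, ∑ f ∈ insert g s, c e f * (X e ω * X f ω))
        - ∑ e ∈ insert g s, c e e * v e) ^ 2 ∂μ ≤ ∑ e ∈ insert g s, c e e ^ 2 * v e
        + 2 * ∑ e ∈ insert g s, ∑ f ∈ insert g s, c e f ^ 2 * (v e * v f)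
    simp_rw [hsq]
    iterate 5 rw [integral_add .of_finite .of_finite]
    simp only [integral_const_mul]
    rw [hXXLL, hXZL, hXZ, hXL, hL2, hsum, Finset.sum_insert hg]
    have h3 := mul_le_mul_of_nonneg_left hfour (sq_nonneg (c g g))
    have h4 : 0 ≤ c g g ^ 2 * (v g * v g) := mul_nonneg (sq_nonneg _) (mul_self_nonneg _)
    linarith [ih]

end QuadraticForm

section Bernoulli

variable {p : ℝ}

lemma isProbabilityMeasure_bern (h0 : 0 ≤ p) (h1 : p ≤ 1) : IsProbabilityMeasure (bern p) := by
  constructor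
  simp only [bern, Measure.add_apply, Measure.smul_apply, measure_univ]
  have : p.toNNReal + (1 - p).toNNReal = 1 := by
    rw [← Real.toNNReal_add h0 (by linarith)]
    simp
  simp only [ENNReal.smul_def, smul_eq_mul, mul_one]
  exact_mod_cast this

lemma integral_bern (h0 : 0 ≤ p) (h1 : p ≤ 1) (f : Bool → ℝ) :
    ∫ x, f x ∂(bern p) = p * f true + (1 - p) * f false := by
  rw [bern, integral_add_measure .of_finite .of_finite, integral_smul_nnreal_measure,
    integral_smul_nnreal_measure, integral_dirac, integral_dirac]
  simp [NNReal.smul_def, h0, h1]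

end Bernoulli

section BlockModel

/-- The edge probability of the pair `e`. -/
noncomputable def edgeProb {n : ℕ} (p q : ℝ) (e : Fin (2 * n) × Fin (2 * n)) : ℝ :=
  if e.1.val < n ↔ e.2.val < n then p else q

/-- The centered edge indicator of the pair `e`. -/
noncomputable def centeredEdge {n : ℕ} (p q : ℝ) (e : Fin (2 * n) × Fin (2 * n))
    (ω : Fin (2 * n) → Fin (2 * n) → Bool) : ℝ :=
  (if ω e.1 e.2 then 1 else 0) - edgeProb p q e

/-- The indicator that `e` is an ordered pair `e.1 ≤ e.2` containing the vertex `j`. -/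
def incidence {m : ℕ} (j : Fin m) (e : Fin m × Fin m) : ℝ :=
  (if e.1 = j then (if j ≤ e.2 then 1 else 0) else 0)
    + (if e.2 = j then (if e.1 < j then 1 else 0) else 0)

lemma incidence_nonneg {m : ℕ} (j : Fin m) (e : Fin m × Fin m) : 0 ≤ incidence j e := by
  unfold incidence
  positivity

lemma incidence_le_one {m : ℕ} (j : Fin m) (e : Fin m × Fin m) : incidence j e ≤ 1 := by
  unfold incidence
  split_ifs with h1 h2 h3 h4 <;> first | (exfalso; subst h1; exact lt_irrefl _ h4) | norm_num

lemma sum_incidence_le {m : ℕ} (e : Fin m × Fin m) : ∑ j, incidence j e ≤ 2 := by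
  simp only [incidence, Finset.sum_add_distrib, Finset.sum_ite_eq, Finset.mem_univ, if_true]
  split_ifs <;> norm_num

lemma sum_incidence_mul {m : ℕ} (j : Fin m) (F : Fin m × Fin m → ℝ) :
    ∑ e, incidence j e * F e = ∑ k, if j ≤ k then F (j, k) else F (k, j) := by
  simp only [incidence, add_mul, Finset.sum_add_distrib, ite_mul, zero_mul, one_mul,
    Fintype.sum_prod_type]
  rw [Finset.sum_comm]
  simp only [Finset.sum_ite_eq', Finset.mem_univ, if_true]
  rw [← Finset.sum_add_distrib]
  refine Finset.sum_congr rfl fun k _ => ?_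
  by_cases h : j ≤ k
  · simp [h, not_lt.2 h]
  · simp [h, not_le.1 h]

variable {n : ℕ} {p q : ℝ}

lemma sum_incidence_mul_edgeProb (j : Fin (2 * n)) :
    ∑ e, incidence j e * edgeProb p q e = n * (p + q) := by
  rw [sum_incidence_mul]
  have h1 : ∀ k : Fin (2 * n), (if j ≤ k then edgeProb p q (j, k) else edgeProb p q (k, j))
      = (fun k : ℕ => if (j.val < n ↔ k < n) then p else q) k := by
    intro k
    simp only [edgeProb]
    split_ifs <;> tauto
  simp_rw [h1]
  rw [Fin.sum_univ_eq_sum_range (fun k : ℕ => if (j.val < n ↔ k < n) then p else q) (2 * n),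
    show Finset.range (2 * n) = Finset.range (n + n) by rw [two_mul], Finset.sum_range_add]
  have h2 : ∑ k ∈ Finset.range n, (if (j.val < n ↔ k < n) then p else q)
      = n * (if j.val < n then p else q) := by
    rw [Finset.sum_congr rfl (g := fun _ => if j.val < n then p else q)]
    · simp
    · intro k hk
      simp [Finset.mem_range.1 hk]
  have h3 : ∑ k ∈ Finset.range n, (if (j.val < n ↔ n + k < n) then p else q)
      = n * (if j.val < n then q else p) := by
    rw [Finset.sum_congr rfl (g := fun _ => if j.val < n then q else p)]
    · simp
    · intro k _
      by_cases h : j.val < n <;> simp [h]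
  rw [h2, h3]
  split_ifs <;> ring

lemma deg_eq_sum_incidence {m : ℕ} (ω : Fin m → Fin m → Bool) (j : Fin m) :
    deg ω j = ∑ e, incidence j e * (if ω e.1 e.2 then 1 else 0) := by
  rw [sum_incidence_mul j fun e => if ω e.1 e.2 then (1 : ℝ) else 0]
  rfl

/-- The degree deviation is a linear form in the centered edge indicators. -/
lemma deg_sub_mean (ω : Fin (2 * n) → Fin (2 * n) → Bool) (j : Fin (2 * n)) :
    deg ω j - n * (p + q) = ∑ e, incidence j e * centeredEdge p q e ω := by
  rw [deg_eq_sum_incidence, ← sum_incidence_mul_edgeProb j, ← Finset.sum_sub_distrib]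
  exact Finset.sum_congr rfl fun e _ => by rw [centeredEdge]; ring

lemma edgeProb_mem (hp : p ∈ Set.Icc (0 : ℝ) 1) (hq : q ∈ Set.Icc (0 : ℝ) 1)
    (e : Fin (2 * n) × Fin (2 * n)) : edgeProb p q e ∈ Set.Icc (0 : ℝ) 1 := by
  unfold edgeProb
  split_ifs <;> assumption

lemma isProbabilityMeasure_edge (hp : p ∈ Set.Icc (0 : ℝ) 1) (hq : q ∈ Set.Icc (0 : ℝ) 1)
    (i j : Fin (2 * n)) :
    IsProbabilityMeasure (bern (if i.val < n ↔ j.val < n then p else q)) :=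
  isProbabilityMeasure_bern (edgeProb_mem hp hq (i, j)).1 (edgeProb_mem hp hq (i, j)).2

lemma isProbabilityMeasure_sbm (hp : p ∈ Set.Icc (0 : ℝ) 1) (hq : q ∈ Set.Icc (0 : ℝ) 1) :
    IsProbabilityMeasure (sbm n p q) := by
  have := isProbabilityMeasure_edge (n := n) hp hq
  unfold sbm
  infer_instance

lemma iIndepFun_centeredEdge (hp : p ∈ Set.Icc (0 : ℝ) 1) (hq : q ∈ Set.Icc (0 : ℝ) 1) :
    iIndepFun (centeredEdge (n := n) p q) (sbm n p q) := by
  have := isProbabilityMeasure_edge (n := n) hp hq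
  have h := iIndepFun_uncurry_infinitePi'
    (fun i j : Fin (2 * n) => bern (if i.val < n ↔ j.val < n then p else q))
    (X := fun i j (x : Bool) => (if x then (1 : ℝ) else 0) - edgeProb p q (i, j))
    fun _ _ => measurable_of_finite _
  simp only [Measure.infinitePi_eq_pi] at h
  exact h

lemma integral_sbm_edge (hp : p ∈ Set.Icc (0 : ℝ) 1) (hq : q ∈ Set.Icc (0 : ℝ) 1)
    (f : Bool → ℝ) (e : Fin (2 * n) × Fin (2 * n)) :
    ∫ ω, f (ω e.1 e.2) ∂(sbm n p q)
      = edgeProb p q e * f true + (1 - edgeProb p q e) * f false := by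
  have := isProbabilityMeasure_edge (n := n) hp hq
  have h := (measurePreserving_eval
      (fun j : Fin (2 * n) => bern (if e.1.val < n ↔ j.val < n then p else q)) e.2).comp
    (measurePreserving_eval (fun i : Fin (2 * n) => Measure.pi fun j : Fin (2 * n) =>
      bern (if i.val < n ↔ j.val < n then p else q)) e.1)
  rw [← integral_bern (edgeProb_mem hp hq e).1 (edgeProb_mem hp hq e).2]
  change _ = ∫ x, f x ∂(bern (if e.1.val < n ↔ e.2.val < n then p else q))
  rw [← h.map_eq, integral_map h.measurable.aemeasurable
    (measurable_of_finite f).aestronglyMeasurable]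
  rfl

lemma integral_centeredEdge (hp : p ∈ Set.Icc (0 : ℝ) 1) (hq : q ∈ Set.Icc (0 : ℝ) 1)
    (e : Fin (2 * n) × Fin (2 * n)) : ∫ ω, centeredEdge p q e ω ∂(sbm n p q) = 0 := by
  refine (integral_sbm_edge hp hq (fun x => (if x then 1 else 0) - edgeProb p q e) e).trans ?_
  simp
  ring

lemma integral_centeredEdge_sq_le (hp : p ∈ Set.Icc (0 : ℝ) 1) (hq : q ∈ Set.Icc (0 : ℝ) 1)
    (e : Fin (2 * n) × Fin (2 * n)) :
    ∫ ω, centeredEdge p q e ω ^ 2 ∂(sbm n p q) ≤ edgeProb p q e := by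
  refine (integral_sbm_edge hp hq
    (fun x => ((if x then 1 else 0) - edgeProb p q e) ^ 2) e).trans_le ?_
  simp
  nlinarith [sq_nonneg (edgeProb p q e)]

lemma abs_centeredEdge_le_one (hp : p ∈ Set.Icc (0 : ℝ) 1) (hq : q ∈ Set.Icc (0 : ℝ) 1)
    (e : Fin (2 * n) × Fin (2 * n)) (ω : Fin (2 * n) → Fin (2 * n) → Bool) :
    |centeredEdge p q e ω| ≤ 1 := by
  obtain ⟨h0, h1⟩ := edgeProb_mem hp hq e
  rw [centeredEdge, abs_le]
  split_ifs <;> constructor <;> linarith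

/-- The number of vertices shared by the ordered pairs `e` and `f`. -/
noncomputable def overlap {m : ℕ} (e f : Fin m × Fin m) : ℝ :=
  ∑ j, incidence j e * incidence j f

lemma overlap_nonneg {m : ℕ} (e f : Fin m × Fin m) : 0 ≤ overlap e f :=
  Finset.sum_nonneg fun j _ => mul_nonneg (incidence_nonneg j e) (incidence_nonneg j f)

lemma overlap_le_sum {m : ℕ} (e f : Fin m × Fin m) : overlap e f ≤ ∑ j, incidence j e :=
  Finset.sum_le_sum fun j _ => mul_le_of_le_one_right (incidence_nonneg j e) (incidence_le_one j f)

lemma overlap_sq_le {m : ℕ} (e f : Fin m × Fin m) : overlap e f ^ 2 ≤ 2 * overlap e f := by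
  nlinarith [overlap_nonneg e f, (overlap_le_sum e f).trans (sum_incidence_le e)]

lemma sum_linearForm_sq {m : ℕ} (x : Fin m × Fin m → ℝ) :
    ∑ j, (∑ e, incidence j e * x e) ^ 2 = ∑ e, ∑ f, overlap e f * (x e * x f) := by
  simp_rw [overlap, sq, Finset.sum_mul_sum, Finset.sum_mul]
  rw [Finset.sum_comm]
  refine Finset.sum_congr rfl fun e _ => ?_
  rw [Finset.sum_comm]
  exact Finset.sum_congr rfl fun f _ => Finset.sum_congr rfl fun j _ => by ring

lemma sum_overlap_self_mul_edgeProb_le (hp : p ∈ Set.Icc (0 : ℝ) 1) (hq : q ∈ Set.Icc (0 : ℝ) 1) :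
    ∑ e : Fin (2 * n) × Fin (2 * n), overlap e e * edgeProb p q e
      ≤ 2 * n * (n * (p + q)) := by
  calc ∑ e : Fin (2 * n) × Fin (2 * n), overlap e e * edgeProb p q e
      ≤ ∑ e, (∑ j, incidence j e) * edgeProb p q e :=
        Finset.sum_le_sum fun e _ =>
          mul_le_mul_of_nonneg_right (overlap_le_sum e e) (edgeProb_mem hp hq e).1
    _ = ∑ j : Fin (2 * n), ∑ e, incidence j e * edgeProb p q e := by
        simp only [Finset.sum_mul]
        exact Finset.sum_comm
    _ = 2 * n * (n * (p + q)) := by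
        simp [sum_incidence_mul_edgeProb]

lemma sum_overlap_mul_edgeProb :
    ∑ e : Fin (2 * n) × Fin (2 * n), ∑ f, overlap e f * (edgeProb p q e * edgeProb p q f)
      = 2 * n * (n * (p + q)) ^ 2 := by
  rw [← sum_linearForm_sq]
  simp [sum_incidence_mul_edgeProb]

/-- Tail bound for the total squared degree deviation in the stochastic block model. -/
lemma sbm_sum_deg_sub_sq_le (hp : p ∈ Set.Icc (0 : ℝ) 1) (hq : q ∈ Set.Icc (0 : ℝ) 1)
    (hn : 0 < n) (hd : 1 ≤ n * (p + q)) :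
    sbm n p q {ω | 4 * (n * (p + q)) * n < ∑ j, (n * (p + q) - deg ω j) ^ 2}
      ≤ ENNReal.ofReal (3 / n) := by
  have := isProbabilityMeasure_sbm (n := n) hp hq
  have hn0 : (0 : ℝ) < n := by exact_mod_cast hn
  set d : ℝ := n * (p + q)
  set v : Fin (2 * n) × Fin (2 * n) → ℝ :=
    fun e => ∫ ω, centeredEdge p q e ω ^ 2 ∂(sbm n p q)
  have hv0 : ∀ e, 0 ≤ v e := fun e => integral_nonneg fun ω => sq_nonneg _
  have hvp : ∀ e, v e ≤ edgeProb p q e := integral_centeredEdge_sq_le hp hq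
  have hp0 : ∀ e : Fin (2 * n) × Fin (2 * n), 0 ≤ edgeProb p q e :=
    fun e => (edgeProb_mem hp hq e).1
  set m : ℝ := ∑ e, overlap e e * v e
  set S : (Fin (2 * n) → Fin (2 * n) → Bool) → ℝ := fun ω =>
    ∑ j, (d - deg ω j) ^ 2 with hS_def
  have hS : ∀ ω, S ω
      = ∑ e, ∑ f, overlap e f * (centeredEdge p q e ω * centeredEdge p q f ω) := by
    intro ω
    rw [← sum_linearForm_sq, hS_def]
    exact Finset.sum_congr rfl fun j _ => by rw [← deg_sub_mean]; ring
  have hdiag := sum_overlap_self_mul_edgeProb_le (n := n) hp hq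
  have hm : m ≤ 2 * n * d := (Finset.sum_le_sum fun e _ =>
    mul_le_mul_of_nonneg_left (hvp e) (overlap_nonneg e e)).trans hdiag
  have hvar : ∫ ω, (S ω - m) ^ 2 ∂(sbm n p q) ≤ 12 * n * d ^ 2 := by
    simp_rw [hS]
    refine (integral_quadraticForm_sub_sq_le (iIndepFun_centeredEdge hp hq)
      (integral_centeredEdge hp hq) (abs_centeredEdge_le_one hp hq) overlap
      (fun e f => Finset.sum_congr rfl fun j _ => mul_comm _ _) Finset.univ).trans ?_
    have h1 : ∑ e, overlap e e ^ 2 * v e ≤ 2 * (2 * n * d) := by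
      refine le_trans ?_ (mul_le_mul_of_nonneg_left hdiag zero_le_two)
      rw [Finset.mul_sum]
      refine Finset.sum_le_sum fun e _ => ?_
      rw [← mul_assoc 2]
      exact mul_le_mul (overlap_sq_le e e) (hvp e) (hv0 e)
        (mul_nonneg zero_le_two (overlap_nonneg e e))
    have h2 : ∑ e, ∑ f, overlap e f ^ 2 * (v e * v f) ≤ 2 * (2 * n * d ^ 2) := by
      rw [← sum_overlap_mul_edgeProb, Finset.mul_sum]
      refine Finset.sum_le_sum fun e _ => ?_
      rw [Finset.mul_sum]
      refine Finset.sum_le_sum fun f _ => ?_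
      rw [← mul_assoc 2]
      exact mul_le_mul (overlap_sq_le e f) (mul_le_mul (hvp e) (hvp f) (hv0 f) (hp0 e))
        (mul_nonneg (hv0 e) (hv0 f)) (mul_nonneg zero_le_two (overlap_nonneg e f))
    have h3 : (n : ℝ) * d ≤ n * d ^ 2 := mul_le_mul_of_nonneg_left (by nlinarith) hn0.le
    change ∑ e, overlap e e ^ 2 * v e + 2 * ∑ e, ∑ f, overlap e f ^ 2 * (v e * v f) ≤ _
    linarith
  have hsub : {ω | 4 * d * n < S ω} ⊆ {ω | (2 * n * d) ^ 2 ≤ (S ω - m) ^ 2} := by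
    intro ω hω
    have hω' : 4 * d * n < S ω := hω
    have hdev : 2 * n * d ≤ S ω - m := by linarith
    exact pow_le_pow_left₀ (by positivity) hdev 2
  have hmarkov := mul_meas_ge_le_integral_of_nonneg (μ := sbm n p q)
    (f := fun ω => (S ω - m) ^ 2) (.of_forall fun ω => sq_nonneg _) .of_finite ((2 * n * d) ^ 2)
  rw [← ofReal_measureReal]
  refine ENNReal.ofReal_le_ofReal ?_
  have hle := measureReal_mono (μ := sbm n p q) hsub
  have hpos : 0 < (2 * n * d) ^ 2 := by positivity
  refine hle.trans ?_
  rw [le_div_iff₀ hn0]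
  have h4 : (2 * n * d) ^ 2 * (sbm n p q).real {ω | (2 * n * d) ^ 2 ≤ (S ω - m) ^ 2}
      ≤ 12 * n * d ^ 2 := hmarkov.trans hvar
  have h5 : 0 < 4 * n * d ^ 2 := by positivity
  refine le_of_mul_le_mul_left ?_ h5
  linarith

end BlockModel

/-- If `a, b ≥ 1` and `d := a + b ≤ n`, then for `G ∼ G_{2n,a/n,b/n}`,
the probability that `∑_j (d - d_j)² > 4·d·n` is at most `21/n`. -/
theorem stmt8 (n : ℕ) (hn : 0 < n) (a b : ℝ) (ha : 1 ≤ a) (hb : 1 ≤ b)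
    (hdn : a + b ≤ n) :
    sbm n (a / n) (b / n)
      {ω | 4 * (a + b) * n < ∑ j, ((a + b) - deg ω j) ^ 2}
      ≤ ENNReal.ofReal (21 / n) := by
  have hn0 : (0 : ℝ) < n := by exact_mod_cast hn
  have hp : a / n ∈ Set.Icc (0 : ℝ) 1 := ⟨by positivity, (div_le_one hn0).2 (by linarith)⟩
  have hq : b / n ∈ Set.Icc (0 : ℝ) 1 := ⟨by positivity, (div_le_one hn0).2 (by linarith)⟩
  have hd : n * (a / n + b / n) = a + b := by field_simp
  have h := sbm_sum_deg_sub_sq_le hp hq hn (by rw [hd]; linarith)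
  rw [hd] at h
  refine h.trans (ENNReal.ofReal_le_ofReal ?_)
  gcongr
  norm_num
end

section
/- There exist constants C > 0 and c > 0 such that the following holds for every constant ε > 0 and all sufficiently large n. Let a, b ≥ 1 with d := a + b satisfying 5·log n < d < n^{1/3 − ε} and a − b ≥ C·sqrt(d), and let G be drawn from the stochastic block model G_{2n, a/n, b/n}. Let N = D^{−1/2} A D^{−1/2} be the normalized adjacency matrix with eigenvalues λ1 ≥ λ2 ≥ … ≥ λ_{2n}, and let w2 be a unit eigenvector of N for λ2, with its sign chosen so that ⟨w2, χ⟩ ≥ 0. Then with probability at least 1 − n^{−c}: ‖w2 − (1/sqrt(2n))·χ‖² ≤ C·d/(a − b)². -/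
open MeasureTheory

/-- The partition indicator vector `χ`: `+1` on the first community, `-1` on the second. -/
noncomputable def chi (n : ℕ) (i : Fin (2*n)) : ℝ := if i.val < n then 1 else -1

/-- The normalized adjacency matrix `N = D^{-1/2} A D^{-1/2}`. -/
noncomputable def normAdj {m : ℕ} (ω : Fin m → Fin m → Bool) : Matrix (Fin m) (Fin m) ℝ :=
  Matrix.diagonal (fun i => (Real.sqrt (deg ω i))⁻¹) * adjOf ω *
    Matrix.diagonal (fun i => (Real.sqrt (deg ω i))⁻¹)

open Matrix

namespace StochasticBlockModel

section

open ProbabilityTheory Finset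

variable {m : ℕ}

lemma isProbabilityMeasure_bern {p : ℝ} (hp : p ∈ Set.Icc (0 : ℝ) 1) :
    IsProbabilityMeasure (bern p) := by
  constructor
  have h : p.toNNReal + (1 - p).toNNReal = 1 := by
    rw [← Real.toNNReal_add hp.1 (by linarith [hp.2])]
    simp
  simp only [bern, Measure.add_apply, Measure.smul_apply, measure_univ, ENNReal.smul_def,
    smul_eq_mul, mul_one]
  exact_mod_cast h

lemma integral_bern {p : ℝ} (hp : p ∈ Set.Icc (0 : ℝ) 1) (f : Bool → ℝ) :
    ∫ b, f b ∂(bern p) = p * f true + (1 - p) * f false := by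
  rw [bern, integral_add_measure .of_finite .of_finite, integral_smul_nnreal_measure,
    integral_smul_nnreal_measure, integral_dirac, integral_dirac]
  simp [NNReal.smul_def, hp.1, hp.2]

/-- The law of independent Bernoulli indicators with parameters `P i j`. -/
noncomputable def edgeMeasure (P : Fin m → Fin m → ℝ) : Measure (Fin m → Fin m → Bool) :=
  Measure.pi fun i => Measure.pi fun j => bern (P i j)

section

variable {P : Fin m → Fin m → ℝ} (hP : ∀ i j, P i j ∈ Set.Icc (0 : ℝ) 1)
include hP

lemma isProbabilityMeasure_edgeMeasure : IsProbabilityMeasure (edgeMeasure P) := by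
  have := fun i j => isProbabilityMeasure_bern (hP i j)
  unfold edgeMeasure
  infer_instance

lemma measurePreserving_edge (i j : Fin m) :
    MeasurePreserving (fun ω : Fin m → Fin m → Bool => ω i j) (edgeMeasure P) (bern (P i j)) := by
  have := fun i j => isProbabilityMeasure_bern (hP i j)
  have h1 := measurePreserving_eval (fun i => Measure.pi fun j => bern (P i j)) i
  have h2 := measurePreserving_eval (fun j => bern (P i j)) j
  exact h2.comp h1

lemma integral_edge (i j : Fin m) (f : Bool → ℝ) :
    ∫ ω, f (ω i j) ∂(edgeMeasure P) = P i j * f true + (1 - P i j) * f false := by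
  rw [← integral_bern (hP i j), ← (measurePreserving_edge hP i j).map_eq,
    integral_map (measurePreserving_edge hP i j).aemeasurable
      (measurable_of_finite f).aestronglyMeasurable]

lemma iIndepFun_edge :
    iIndepFun (fun (e : Fin m × Fin m) (ω : Fin m → Fin m → Bool) => ω e.1 e.2)
      (edgeMeasure P) := by
  have hb := fun i j => isProbabilityMeasure_bern (hP i j)
  have := isProbabilityMeasure_edgeMeasure hP
  rw [iIndepFun_iff_measure_inter_preimage_eq_mul]
  intro S s _
  let t : Fin m → Fin m → Set Bool := fun i j => if (i, j) ∈ S then s (i, j) else Set.univ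
  have h1 : (⋂ e ∈ S, (fun ω : Fin m → Fin m → Bool => ω e.1 e.2) ⁻¹' s e)
      = Set.univ.pi fun i => Set.univ.pi fun j => t i j := by
    ext ω
    simp only [Set.mem_iInter, Set.mem_preimage, Set.mem_pi, Set.mem_univ, true_imp_iff, t,
      Prod.forall]
    refine forall₂_congr fun i j => ?_
    by_cases h : (i, j) ∈ S <;> simp [h]
  have h2 : ∀ e ∈ S, edgeMeasure P ((fun ω : Fin m → Fin m → Bool => ω e.1 e.2) ⁻¹' s e)
      = bern (P e.1 e.2) (t e.1 e.2) := by
    intro e he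
    rw [(measurePreserving_edge hP e.1 e.2).measure_preimage
      (Set.toFinite _).measurableSet.nullMeasurableSet]
    simp [t, he]
  rw [h1, Finset.prod_congr rfl h2, edgeMeasure, Measure.pi_pi]
  simp_rw [Measure.pi_pi]
  rw [← Fintype.prod_prod_type' fun i j => bern (P i j) (t i j)]
  symm
  apply Finset.prod_subset (Finset.subset_univ S)
  intro e _ he
  simp only [t, he, if_false]
  exact measure_univ

end

/-- The symmetric matrix whose entries are functions of independent edge indicators. -/
def symMatrix (f : Fin m → Fin m → Bool → ℝ) (ω : Fin m → Fin m → Bool) :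
    Matrix (Fin m) (Fin m) ℝ :=
  Matrix.of fun i j => f (min i j) (max i j) (ω (min i j) (max i j))

lemma min_max_eq_iff {i j i' j' : Fin m} :
    ((min i j, max i j) : Fin m × Fin m) = (min i' j', max i' j') ↔ s(i, j) = s(i', j') := by
  rw [Sym2.eq_iff, Prod.ext_iff]
  grind

lemma isSymm_symMatrix (f : Fin m → Fin m → Bool → ℝ) (ω : Fin m → Fin m → Bool) :
    (symMatrix f ω).IsSymm := by
  ext i j
  simp [symMatrix, min_comm, max_comm]

/-- The number of `t` such that the unordered pair `{u t, v t}` is the ordered pair `e`. -/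
def multiplicity {L : ℕ} (u v : Fin L → Fin m) (e : Fin m × Fin m) : ℕ :=
  #{t | (min (u t) (v t), max (u t) (v t)) = e}

lemma integral_prod_symMatrix {P : Fin m → Fin m → ℝ} (hP : ∀ i j, P i j ∈ Set.Icc (0 : ℝ) 1)
    (f : Fin m → Fin m → Bool → ℝ) {L : ℕ} (u v : Fin L → Fin m) :
    ∫ ω, ∏ t, symMatrix f ω (u t) (v t) ∂(edgeMeasure P) =
      ∏ e : Fin m × Fin m, (P e.1 e.2 * f e.1 e.2 true ^ multiplicity u v e +
        (1 - P e.1 e.2) * f e.1 e.2 false ^ multiplicity u v e) := by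
  have h1 : ∀ ω : Fin m → Fin m → Bool, ∏ t, symMatrix f ω (u t) (v t) =
      ∏ e : Fin m × Fin m, f e.1 e.2 (ω e.1 e.2) ^ multiplicity u v e := by
    intro ω
    rw [← Finset.prod_fiberwise_of_maps_to (t := Finset.univ)
      (g := fun t => (min (u t) (v t), max (u t) (v t))) (by simp)]
    refine Finset.prod_congr rfl fun e _ => ?_
    rw [multiplicity, ← Finset.prod_const]
    refine Finset.prod_congr rfl fun t ht => ?_
    simp only [Finset.mem_filter, Finset.mem_univ, true_and] at ht
    subst ht
    rfl
  simp_rw [h1]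
  refine (iIndepFun.integral_fun_prod_eq_prod_integral
    ((iIndepFun_edge hP).comp (fun e b => f e.1 e.2 b ^ multiplicity u v e)
      fun e => measurable_of_finite _)
    fun e => (measurable_of_finite _).aestronglyMeasurable).trans ?_
  refine Finset.prod_congr rfl fun e _ => ?_
  exact integral_edge hP e.1 e.2 fun b => f e.1 e.2 b ^ multiplicity u v e

end

section

open ProbabilityTheory Finset

section Walks

variable {α β : Type*} {L : ℕ}

/-- The unordered edges traversed by the walk `w`. -/
def walkEdge (w : Fin (L + 1) → α) (t : Fin L) : Sym2 α := s(w t.castSucc, w t.succ)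

/-- A closed walk that traverses no edge exactly once. -/
def IsRepeatingWalk (w : Fin (L + 1) → α) : Prop :=
  w 0 = w (Fin.last L) ∧ ∀ t, ∃ t', t' ≠ t ∧ walkEdge w t' = walkEdge w t

instance [DecidableEq α] (w : Fin (L + 1) → α) : Decidable (IsRepeatingWalk w) := by
  unfold IsRepeatingWalk; infer_instance

lemma walkEdge_eq_iff_of_ker_eq {w : Fin (L + 1) → α} {w' : Fin (L + 1) → β}
    (h : ∀ s t, w s = w t ↔ w' s = w' t) (s t : Fin L) :
    walkEdge w s = walkEdge w t ↔ walkEdge w' s = walkEdge w' t := by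
  simp only [walkEdge, Sym2.eq_iff, h]

lemma isRepeatingWalk_iff_of_ker_eq {w : Fin (L + 1) → α} {w' : Fin (L + 1) → β}
    (h : ∀ s t, w s = w t ↔ w' s = w' t) : IsRepeatingWalk w ↔ IsRepeatingWalk w' := by
  simp only [IsRepeatingWalk, h, walkEdge_eq_iff_of_ker_eq h]

lemma card_image_eq_of_ker_eq {γ : Type*} [Fintype γ] [DecidableEq α] [DecidableEq β] {f : γ → α}
    {g : γ → β} (h : ∀ s t, f s = f t ↔ g s = g t) :
    #(univ.image f) = #(univ.image g) := by
  refine Finset.card_bij' (fun a ha => g (Finset.mem_image.1 ha).choose)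
    (fun b hb => f (Finset.mem_image.1 hb).choose) (by simp) (by simp) ?_ ?_
  · intro a ha
    generalize_proofs h1 h2
    exact ((h _ _).2 h2.choose_spec.2).trans h1.choose_spec.2
  · intro a ha
    generalize_proofs h1 h2
    exact ((h _ _).1 h2.choose_spec.2).trans h1.choose_spec.2

lemma card_image_walk_le [DecidableEq α] (w : Fin (L + 1) → α) :
    #(univ.image w) ≤ #(univ.image (walkEdge w)) + 1 := by
  induction L with
  | zero => simp [Finset.univ_unique]
  | succ L ih =>
    have h1 : univ.image w = insert (w (Fin.last _)) (univ.image (w ∘ Fin.castSucc)) := by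
      ext x
      simp only [mem_image, mem_univ, true_and, mem_insert, Function.comp, Fin.exists_fin_succ']
      grind
    have h2 : univ.image (walkEdge w) = insert (s(w (Fin.last L).castSucc, w (Fin.last _)))
        (univ.image (walkEdge (w ∘ Fin.castSucc))) := by
      ext x
      simp only [mem_image, mem_univ, true_and, mem_insert, Fin.exists_fin_succ', walkEdge,
        Function.comp, Fin.succ_last, Fin.succ_castSucc]
      grind
    have := ih (w ∘ Fin.castSucc)
    rw [h1, h2]
    by_cases h : w (Fin.last _) ∈ univ.image (w ∘ Fin.castSucc)
    · rw [Finset.insert_eq_of_mem h]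
      exact this.trans (Nat.succ_le_succ (Finset.card_le_card (Finset.subset_insert _ _)))
    · rw [Finset.card_insert_of_notMem h, Finset.card_insert_of_notMem]
      · lia
      · intro hmem
        obtain ⟨t, -, ht⟩ := Finset.mem_image.1 hmem
        apply h
        have : w (Fin.last (L + 1)) ∈ walkEdge (w ∘ Fin.castSucc) t := by rw [ht]; simp
        rw [walkEdge, Sym2.mem_iff] at this
        rcases this with h | h <;> rw [h] <;> exact Finset.mem_image_of_mem _ (Finset.mem_univ _)

lemma IsRepeatingWalk.two_mul_card_le [DecidableEq α] {w : Fin (L + 1) → α}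
    (hw : IsRepeatingWalk w) : 2 * #(univ.image (walkEdge w)) ≤ L := by
  have h1 := Finset.card_eq_sum_card_image (walkEdge w) univ
  rw [Finset.card_univ, Fintype.card_fin] at h1
  refine le_of_le_of_eq ?_ h1.symm
  rw [mul_comm, ← smul_eq_mul]
  refine Finset.card_nsmul_le_sum _ _ _ fun e he => ?_
  obtain ⟨t, -, rfl⟩ := Finset.mem_image.1 he
  obtain ⟨t', ht, ht'⟩ := hw.2 t
  rw [Nat.succ_le_iff, Finset.one_lt_card]
  exact ⟨t', by simp [ht'], t, by simp, ht⟩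

lemma card_ker_eq [Fintype β] [DecidableEq α] [DecidableEq β] (w : Fin L → α) :
    #{w' : Fin L → β | ∀ s t, w s = w t ↔ w' s = w' t} =
      (Fintype.card β).descFactorial #(univ.image w) := by
  have e : {w' : Fin L → β // ∀ s t, w s = w t ↔ w' s = w' t} ≃ (univ.image w ↪ β) :=
    { toFun := fun w' => ⟨fun a => w'.1 (Finset.mem_image.1 a.2).choose, by
        intro a b hab
        have ha := (Finset.mem_image.1 a.2).choose_spec.2
        have hb := (Finset.mem_image.1 b.2).choose_spec.2
        have := (w'.2 _ _).2 hab
        exact Subtype.ext (ha.symm.trans (this.trans hb))⟩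
      invFun := fun φ => ⟨fun t => φ ⟨w t, Finset.mem_image_of_mem _ (Finset.mem_univ _)⟩, by
        intro s t
        simp [φ.injective.eq_iff]⟩
      left_inv := by
        intro w'
        ext t
        have h := Finset.mem_image.1 (Finset.mem_image_of_mem w (Finset.mem_univ t))
        exact (w'.2 _ _).1 h.choose_spec.2
      right_inv := by
        intro φ
        ext a
        exact congrArg φ (Subtype.ext (Finset.mem_image.1 a.2).choose_spec.2) }
  rw [← Fintype.card_subtype, Fintype.card_congr e, Fintype.card_embedding_eq, Fintype.card_coe]

/-- Comparison of weighted closed walks on `N` vertices with closed walks on `r` vertices. -/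
lemma sum_repeatingWalk_le {N r k : ℕ} {q : ℝ} (hq0 : 0 ≤ q) (hq1 : q ≤ 1) (hN : 1 ≤ N)
    (hNq : 1 ≤ N * q) (hr : N * q + k ≤ r) :
    ∑ w : Fin (2 * k + 1) → Fin N with IsRepeatingWalk w, q ^ #(univ.image (walkEdge w)) ≤
      N * #{w : Fin (2 * k + 1) → Fin r | IsRepeatingWalk w} := by
  classical
  have hkr : k + 1 ≤ r := by
    have : ((k + 1 : ℕ) : ℝ) ≤ r := by push_cast; linarith
    exact_mod_cast this
  let R : (Fin (2 * k + 1) → Fin N) → (Fin (2 * k + 1) → Fin r) → Prop :=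
    fun w w' => ∀ s t, w s = w t ↔ w' s = w' t
  have hv {n : ℕ} (w : Fin (2 * k + 1) → Fin n) (hw : IsRepeatingWalk w) :
      #(univ.image w) ≤ k + 1 := by
    have := card_image_walk_le w
    have := hw.two_mul_card_le
    lia
  have hpos {v : ℕ} (h : v ≤ k + 1) : (0 : ℝ) < r.descFactorial v := by
    exact_mod_cast Nat.pos_of_ne_zero (by rw [Ne, Nat.descFactorial_eq_zero_iff_lt]; lia)
  calc ∑ w : Fin (2 * k + 1) → Fin N with IsRepeatingWalk w, q ^ #(univ.image (walkEdge w))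
      = ∑ w : Fin (2 * k + 1) → Fin N with IsRepeatingWalk w,
          ∑ w' : Fin (2 * k + 1) → Fin r with IsRepeatingWalk w', if R w w' then
            q ^ #(univ.image (walkEdge w')) / r.descFactorial #(univ.image w') else 0 := by
        refine Finset.sum_congr rfl fun w hw => ?_
        simp only [Finset.mem_filter, Finset.mem_univ, true_and] at hw
        rw [← Finset.sum_filter, Finset.filter_filter]
        have h1 : (univ.filter fun w' : Fin (2 * k + 1) → Fin r => IsRepeatingWalk w' ∧ R w w')
            = univ.filter fun w' => ∀ s t, w s = w t ↔ w' s = w' t := by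
          ext w'
          simp only [Finset.mem_filter, Finset.mem_univ, true_and]
          exact ⟨fun h => h.2, fun h => ⟨(isRepeatingWalk_iff_of_ker_eq h).1 hw, h⟩⟩
        rw [h1, Finset.sum_congr rfl (g := fun _ => q ^ #(univ.image (walkEdge w)) /
          r.descFactorial #(univ.image w)), Finset.sum_const, card_ker_eq, Fintype.card_fin,
          nsmul_eq_mul]
        · have := hpos (hv w hw)
          field_simp
        · intro w' hw'
          simp only [Finset.mem_filter, Finset.mem_univ, true_and] at hw'
          rw [card_image_eq_of_ker_eq hw', card_image_eq_of_ker_eq (walkEdge_eq_iff_of_ker_eq hw')]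
    _ = ∑ w' : Fin (2 * k + 1) → Fin r with IsRepeatingWalk w',
          ∑ w : Fin (2 * k + 1) → Fin N with IsRepeatingWalk w, if R w w' then
            q ^ #(univ.image (walkEdge w')) / r.descFactorial #(univ.image w') else 0 :=
        Finset.sum_comm
    _ ≤ ∑ w' : Fin (2 * k + 1) → Fin r with IsRepeatingWalk w', (N : ℝ) := by
        refine Finset.sum_le_sum fun w' hw' => ?_
        simp only [Finset.mem_filter, Finset.mem_univ, true_and] at hw'
        rw [← Finset.sum_filter, Finset.sum_const, Finset.filter_filter, nsmul_eq_mul]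
        have h1 : #(univ.filter fun w : Fin (2 * k + 1) → Fin N => IsRepeatingWalk w ∧ R w w')
            ≤ N ^ #(univ.image w') := by
          calc _ ≤ #(univ.filter fun w : Fin (2 * k + 1) → Fin N =>
                ∀ s t, w' s = w' t ↔ w s = w t) := by
                refine Finset.card_le_card fun w hw => ?_
                simp only [Finset.mem_filter, Finset.mem_univ, true_and] at hw ⊢
                exact fun s t => (hw.2 s t).symm
            _ ≤ _ := by
                rw [card_ker_eq, Fintype.card_fin]
                exact Nat.descFactorial_le_pow _ _
        set v := #(univ.image w') with hvdef
        have hv1 : v ≤ k + 1 := hv w' hw'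
        have hv2 := card_image_walk_le w'
        have hv0 : 1 ≤ v := Finset.card_pos.2 ⟨w' 0, Finset.mem_image_of_mem _ (mem_univ _)⟩
        obtain ⟨u, hu⟩ : ∃ u, v = u + 1 := ⟨v - 1, by lia⟩
        have h2 : (N * q) ^ u ≤ r.descFactorial v := by
          have h3 := Nat.pow_sub_le_descFactorial r v
          calc (N * q) ^ u ≤ (N * q) ^ v := pow_le_pow_right₀ hNq (by lia)
            _ ≤ ((r + 1 - v : ℕ) : ℝ) ^ v := by
                gcongr
                rw [Nat.cast_sub (by lia)]
                have : (v : ℝ) ≤ k + 1 := by exact_mod_cast hv1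
                push_cast
                linarith
            _ ≤ _ := by exact_mod_cast h3
        have h4 : q ^ #(univ.image (walkEdge w')) ≤ q ^ u :=
          pow_le_pow_of_le_one hq0 hq1 (by lia)
        rw [mul_div_assoc', div_le_iff₀ (hpos hv1)]
        calc _ ≤ (N : ℝ) ^ v * q ^ u := by
              gcongr
              exact_mod_cast h1
          _ = N * (N * q) ^ u := by rw [hu]; ring
          _ ≤ _ := by gcongr
    _ = _ := by rw [Finset.sum_const, nsmul_eq_mul, mul_comm]

end Walks

section Trace

variable {ι : Type*} [Fintype ι] [DecidableEq ι]

lemma pow_apply_eq_sum_walks (M : Matrix ι ι ℝ) (L : ℕ) (i j : ι) :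
    (M ^ L) i j = ∑ w : Fin (L + 1) → ι with w 0 = i ∧ w (Fin.last L) = j,
      ∏ t : Fin L, M (w t.castSucc) (w t.succ) := by
  rw [Finset.sum_filter]
  induction L generalizing i with
  | zero =>
    rw [← (Equiv.funUnique (Fin 1) ι).symm.sum_comp]
    simp [Matrix.one_apply, ite_and]
  | succ L ih =>
    rw [pow_succ', Matrix.mul_apply, ← (Fin.consEquiv fun _ => ι).sum_comp,
      Fintype.sum_prod_type]
    simp_rw [ih]
    simp only [Fin.consEquiv_apply, Fin.cons_zero, ← Fin.succ_last, Fin.cons_succ,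
      Fin.prod_univ_succ, Fin.castSucc_zero, ← Fin.succ_castSucc, Finset.mul_sum]
    rw [Finset.sum_comm]
    conv_rhs => rw [Finset.sum_comm]
    refine Finset.sum_congr rfl fun w _ => ?_
    simp [ite_and]

lemma trace_pow_eq_sum_walks (M : Matrix ι ι ℝ) (L : ℕ) :
    (M ^ L).trace = ∑ w : Fin (L + 1) → ι with w 0 = w (Fin.last L),
      ∏ t : Fin L, M (w t.castSucc) (w t.succ) := by
  simp only [Matrix.trace, Matrix.diag, pow_apply_eq_sum_walks, Finset.sum_filter]
  rw [Finset.sum_comm]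
  refine Finset.sum_congr rfl fun w _ => ?_
  simp [ite_and, eq_comm]

end Trace

end

section

open ProbabilityTheory Finset

variable {m L : ℕ}

lemma card_multiplicity_ne_zero (w : Fin (L + 1) → Fin m) :
    #{e : Fin m × Fin m | multiplicity (fun t : Fin L => w t.castSucc) (fun t => w t.succ) e ≠ 0} =
      #(univ.image (walkEdge w)) := by
  rw [← card_image_eq_of_ker_eq (f := fun t : Fin L =>
    ((min (w t.castSucc) (w t.succ), max (w t.castSucc) (w t.succ)) : Fin m × Fin m))
    (g := walkEdge w)
    fun s t => min_max_eq_iff]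
  congr 1
  ext e
  simp [multiplicity, Finset.filter_eq_empty_iff]

lemma isRepeatingWalk_iff_multiplicity_ne_one {w : Fin (L + 1) → Fin m}
    (hw : w 0 = w (Fin.last L)) : IsRepeatingWalk w ↔
      ∀ e, multiplicity (fun t : Fin L => w t.castSucc) (fun t => w t.succ) e ≠ 1 := by
  simp only [IsRepeatingWalk, hw, true_and, multiplicity, Ne, Finset.card_eq_one, not_exists]
  constructor
  · intro h e t ht
    have h1 : t ∈ ({t} : Finset (Fin L)) := Finset.mem_singleton_self t
    rw [← ht, Finset.mem_filter] at h1
    obtain ⟨t', hne, heq⟩ := h t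
    have h2 : t' ∈ ({t} : Finset (Fin L)) := by
      rw [← ht, Finset.mem_filter]
      exact ⟨Finset.mem_univ _, (min_max_eq_iff.2 heq).trans h1.2⟩
    exact hne (Finset.mem_singleton.1 h2)
  · intro h t
    by_contra! hcon
    refine h (min (w t.castSucc) (w t.succ), max (w t.castSucc) (w t.succ)) t ?_
    ext t'
    simp only [Finset.mem_filter, Finset.mem_univ, true_and, Finset.mem_singleton]
    refine ⟨fun h1 => ?_, fun h1 => by rw [h1]⟩
    by_contra hne
    exact hcon t' hne (min_max_eq_iff.1 h1)

lemma abs_centered_bernoulli_moment_le {p q : ℝ} (hp : p ∈ Set.Icc (0 : ℝ) 1) (hpq : p ≤ q)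
    {j : ℕ} (hj : j ≠ 0) : |p * (1 - p) ^ j + (1 - p) * (0 - p) ^ j| ≤ q := by
  obtain ⟨h0, h1⟩ := hp
  obtain rfl | hj2 : j = 1 ∨ 2 ≤ j := by lia
  · ring_nf
    simpa using h0.trans hpq
  · obtain ⟨i, rfl⟩ : ∃ i, j = i + 2 := ⟨j - 2, by lia⟩
    have hp1 : 0 ≤ 1 - p := by linarith
    have h2 : (1 - p) ^ (i + 1) ≤ 1 - p := by
      simpa [pow_succ] using mul_le_mul_of_nonneg_right (pow_le_one₀ (n := i) hp1 (by linarith)) hp1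
    have h3 : p ^ (i + 1) ≤ p := by
      simpa [pow_succ] using mul_le_mul_of_nonneg_right (pow_le_one₀ (n := i) h0 h1) h0
    calc _ ≤ |p * (1 - p) ^ (i + 2)| + |(1 - p) * (0 - p) ^ (i + 2)| := abs_add_le _ _
      _ = p * (1 - p) * ((1 - p) ^ (i + 1) + p ^ (i + 1)) := by
        rw [abs_mul, abs_mul, abs_pow, abs_pow, zero_sub, abs_neg, abs_of_nonneg h0,
          abs_of_nonneg hp1]
        ring
      _ ≤ p * (1 - p) * ((1 - p) + p) := by gcongr
      _ ≤ q := by nlinarith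

lemma one_le_two_neg_one_moment {j : ℕ} (hj : j ≠ 1) :
    (1 : ℝ) ≤ 1 / 3 * 2 ^ j + (1 - 1 / 3) * (-1) ^ j := by
  rcases j with _ | _ | j
  · norm_num
  · simp at hj
  · rcases j with _ | j
    · norm_num
    · have h1 : (1 : ℝ) ≤ 2 ^ j := one_le_pow₀ (by norm_num)
      have h2 : (2 : ℝ) ^ (j + 1 + 1 + 1) = 8 * 2 ^ j := by ring
      rcases neg_one_pow_eq_or ℝ (j + 1 + 1 + 1) with h | h <;> rw [h, h2] <;> linarith

/-- The centered adjacency matrix of a random graph with edge probabilities `P`. -/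
def centeredAdj (P : Fin m → Fin m → ℝ) : (Fin m → Fin m → Bool) → Matrix (Fin m) (Fin m) ℝ :=
  symMatrix fun i j b => (if b then 1 else 0) - P i j

/-- A symmetric matrix with entries in `{2, -1}`. -/
def twoNegOneMatrix : (Fin m → Fin m → Bool) → Matrix (Fin m) (Fin m) ℝ :=
  symMatrix fun _ _ b => if b then 2 else -1

lemma integral_trace_pow_symMatrix {P : Fin m → Fin m → ℝ}
    (hP : ∀ i j, P i j ∈ Set.Icc (0 : ℝ) 1) (f : Fin m → Fin m → Bool → ℝ) (L : ℕ) :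
    ∫ ω, (symMatrix f ω ^ L).trace ∂(edgeMeasure P) =
      ∑ w : Fin (L + 1) → Fin m with w 0 = w (Fin.last L),
        ∏ e : Fin m × Fin m, (P e.1 e.2 * f e.1 e.2 true ^
          multiplicity (fun t : Fin L => w t.castSucc) (fun t => w t.succ) e +
        (1 - P e.1 e.2) * f e.1 e.2 false ^
          multiplicity (fun t : Fin L => w t.castSucc) (fun t => w t.succ) e) := by
  have := isProbabilityMeasure_edgeMeasure hP
  simp_rw [trace_pow_eq_sum_walks]
  rw [integral_finsetSum _ fun _ _ => .of_finite]
  exact Finset.sum_congr rfl fun w _ => integral_prod_symMatrix hP f _ _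

lemma integral_trace_pow_centeredAdj_le {P : Fin m → Fin m → ℝ}
    (hP : ∀ i j, P i j ∈ Set.Icc (0 : ℝ) 1) {q : ℝ} (hPq : ∀ i j, P i j ≤ q) (L : ℕ) :
    ∫ ω, (centeredAdj P ω ^ L).trace ∂(edgeMeasure P) ≤
      ∑ w : Fin (L + 1) → Fin m with IsRepeatingWalk w, q ^ #(univ.image (walkEdge w)) := by
  rw [centeredAdj, integral_trace_pow_symMatrix hP]
  simp only [if_true, Bool.false_eq_true, if_false]
  have h : ∀ w : Fin (L + 1) → Fin m, IsRepeatingWalk w → w 0 = w (Fin.last L) := fun w h => h.1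
  rw [Finset.sum_filter, Finset.sum_filter]
  refine Finset.sum_le_sum fun w _ => ?_
  by_cases hw : w 0 = w (Fin.last L)
  swap
  · rw [if_neg hw, if_neg (mt (h w) hw)]
  rw [if_pos hw]
  split_ifs with hrep
  · refine (le_abs_self _).trans ?_
    rw [Finset.abs_prod, ← card_multiplicity_ne_zero, ← Finset.prod_const, Finset.prod_filter]
    refine Finset.prod_le_prod (fun _ _ => abs_nonneg _) fun e _ => ?_
    split_ifs with he
    · exact abs_centered_bernoulli_moment_le (hP _ _) (hPq _ _) he
    · rw [not_not] at he
      simp [he]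
  · rw [isRepeatingWalk_iff_multiplicity_ne_one hw] at hrep
    push Not at hrep
    obtain ⟨e, he⟩ := hrep
    refine le_of_eq (Finset.prod_eq_zero (Finset.mem_univ e) ?_)
    rw [he]
    ring

lemma third_mem_Icc : ∀ _ _ : Fin m, (1 / 3 : ℝ) ∈ Set.Icc (0 : ℝ) 1 := by
  intros; constructor <;> norm_num

lemma card_repeatingWalk_le (L : ℕ) :
    (#{w : Fin (L + 1) → Fin m | IsRepeatingWalk w} : ℝ) ≤
      ∫ ω, (twoNegOneMatrix ω ^ L).trace ∂(edgeMeasure (m := m) fun _ _ => 1 / 3) := by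
  rw [twoNegOneMatrix, integral_trace_pow_symMatrix third_mem_Icc]
  simp only [if_true, Bool.false_eq_true, if_false]
  rw [Finset.sum_filter, Finset.card_filter, Nat.cast_sum]
  refine Finset.sum_le_sum fun w _ => ?_
  have hnn (j : ℕ) : (0 : ℝ) ≤ 1 / 3 * 2 ^ j + (1 - 1 / 3) * (-1) ^ j := by
    by_cases hj : j = 1
    · rw [hj]; norm_num
    · linarith [one_le_two_neg_one_moment hj]
  split_ifs with hrep hw hw
  · have := (isRepeatingWalk_iff_multiplicity_ne_one hw).1 hrep
    rw [Nat.cast_one]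
    refine (Finset.prod_const_one (s := Finset.univ (α := Fin m × Fin m))).symm.trans_le ?_
    exact Finset.prod_le_prod (fun _ _ => zero_le_one) fun e _ =>
      one_le_two_neg_one_moment (this e)
  · exact absurd hrep.1 hw
  · rw [Nat.cast_zero]
    exact Finset.prod_nonneg fun e _ => hnn _
  · simp

end

section

open ProbabilityTheory Finset
open scoped NNReal RealInnerProductSpace

variable {m : ℕ}

section SpecNorm

lemma specNorm_nonneg (M : Matrix (Fin m) (Fin m) ℝ) : 0 ≤ specNorm M := norm_nonneg _

lemma specNorm_sq_le_sum (M : Matrix (Fin m) (Fin m) ℝ) :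
    specNorm M ^ 2 ≤ ∑ i, ∑ j, M i j ^ 2 := by
  have h0 : 0 ≤ ∑ i, ∑ j, M i j ^ 2 := by positivity
  rw [← Real.le_sqrt (specNorm_nonneg M) h0]
  refine ContinuousLinearMap.opNorm_le_bound _ (Real.sqrt_nonneg _) fun x => ?_
  rw [EuclideanSpace.norm_eq, EuclideanSpace.norm_eq, ← Real.sqrt_mul h0]
  refine Real.sqrt_le_sqrt ?_
  simp only [Real.norm_eq_abs, sq_abs]
  rw [Finset.sum_mul]
  exact Finset.sum_le_sum fun i _ =>
    Finset.sum_mul_sq_le_sq_mul_sq univ (fun j => M i j) fun j => x j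

lemma isSelfAdjoint_toEuclideanCLM {M : Matrix (Fin m) (Fin m) ℝ} (hM : M.IsSymm) :
    IsSelfAdjoint (toEuclideanCLM (𝕜 := ℝ) M) := by
  have h : star M = M := by
    rw [star_eq_conjTranspose, conjTranspose_eq_transpose_of_trivial]
    exact hM
  rw [IsSelfAdjoint, ← map_star, h]

lemma specNorm_pow_le_trace {M : Matrix (Fin m) (Fin m) ℝ} (hM : M.IsSymm) (n : ℕ) :
    specNorm M ^ (2 * 2 ^ n) ≤ (M ^ (2 * 2 ^ n)).trace := by
  have h1 : specNorm M ^ 2 ^ n = specNorm (M ^ 2 ^ n) := by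
    rw [specNorm, specNorm, map_pow, (isSelfAdjoint_toEuclideanCLM hM).norm_pow_two_pow]
  rw [mul_comm, pow_mul, h1]
  refine (specNorm_sq_le_sum _).trans_eq ?_
  rw [pow_mul, sq (M ^ 2 ^ n)]
  simp only [Matrix.trace, Matrix.diag, Matrix.mul_apply]
  refine Finset.sum_congr rfl fun i _ => Finset.sum_congr rfl fun j _ => ?_
  rw [(hM.pow (2 ^ n)).apply i j, sq]

lemma dotProduct_mulVec_eq_inner (M : Matrix (Fin m) (Fin m) ℝ) (x y : Fin m → ℝ) :
    y ⬝ᵥ M *ᵥ x = ⟪WithLp.toLp 2 y, toEuclideanCLM (𝕜 := ℝ) M (WithLp.toLp 2 x)⟫ := by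
  rw [inner_toEuclideanCLM]

lemma trace_pow_le (M : Matrix (Fin m) (Fin m) ℝ) (L : ℕ) :
    (M ^ L).trace ≤ m * specNorm M ^ L := by
  have h : ∀ i, (M ^ L) i i ≤ specNorm M ^ L := by
    intro i
    have h1 : (M ^ L) i i = ⟪EuclideanSpace.single i (1 : ℝ),
        toEuclideanCLM (𝕜 := ℝ) (M ^ L) (EuclideanSpace.single i (1 : ℝ))⟫ := by
      rw [inner_toEuclideanCLM]
      simp [Matrix.mulVec, dotProduct]
    rw [h1]
    calc _ ≤ ‖EuclideanSpace.single i (1 : ℝ)‖ *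
          ‖toEuclideanCLM (𝕜 := ℝ) (M ^ L) (EuclideanSpace.single i (1 : ℝ))‖ :=
          real_inner_le_norm _ _
      _ ≤ ‖EuclideanSpace.single i (1 : ℝ)‖ * (‖toEuclideanCLM (𝕜 := ℝ) (M ^ L)‖ *
          ‖EuclideanSpace.single i (1 : ℝ)‖) := by
          gcongr
          exact ContinuousLinearMap.le_opNorm _ _
      _ = ‖toEuclideanCLM (𝕜 := ℝ) M ^ L‖ := by simp
      _ ≤ _ := by
        rcases Nat.eq_zero_or_pos L with rfl | hL
        · rw [pow_zero, pow_zero]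
          exact ContinuousLinearMap.norm_id_le
        · exact norm_pow_le' _ hL
  calc _ ≤ ∑ _i : Fin m, specNorm M ^ L := Finset.sum_le_sum fun i _ => h i
    _ = _ := by simp

end SpecNorm

section Net

variable {E : Type*} [NormedAddCommGroup E] [NormedSpace ℝ E] [FiniteDimensional ℝ E]

/-- A ball of radius two is covered by at most `5 ^ d` unit balls. -/
lemma exists_finset_net : ∃ T : Finset E, #T ≤ 5 ^ Module.finrank ℝ E ∧ (∀ x ∈ T, ‖x‖ ≤ 2) ∧
    ∀ x : E, ‖x‖ ≤ 2 → ∃ y ∈ T, ‖x - y‖ < 1 := by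
  classical
  let good : Finset E → Prop := fun s =>
    (∀ c ∈ s, ‖c‖ ≤ 2) ∧ ∀ c ∈ s, ∀ d ∈ s, c ≠ d → 1 ≤ ‖c - d‖
  have hb : ∀ s, good s → #s ≤ 5 ^ Module.finrank ℝ E := fun s hs =>
    Besicovitch.card_le_of_separated s hs.1 hs.2
  let Q : ℕ → Prop := fun n => ∃ s, good s ∧ #s = n
  have hQ0 : Q 0 := ⟨∅, by simp [good]⟩
  have hQ : Q (Nat.findGreatest Q (5 ^ Module.finrank ℝ E)) :=
    Nat.findGreatest_spec (Nat.zero_le _) hQ0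
  obtain ⟨T, hT, hcard⟩ := hQ
  refine ⟨T, hb T hT, hT.1, fun x hx => ?_⟩
  by_contra! hcon
  have hxT : x ∉ T := fun h => by
    have := hcon x h
    norm_num at this
  have hg : good (insert x T) := by
    refine ⟨fun c hc => ?_, fun c hc d hd hne => ?_⟩
    · rcases Finset.mem_insert.1 hc with rfl | hc
      · exact hx
      · exact hT.1 c hc
    · rcases Finset.mem_insert.1 hc with rfl | hc' <;>
        rcases Finset.mem_insert.1 hd with rfl | hd'
      · exact absurd rfl hne
      · exact hcon d hd'
      · rw [norm_sub_rev]; exact hcon c hc'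
      · exact hT.2 c hc' d hd' hne
  have h1 := Nat.le_findGreatest (P := Q) (hb _ hg) ⟨_, hg, rfl⟩
  rw [Finset.card_insert_of_notMem hxT] at h1
  lia

end Net

lemma specNorm_le_of_net {T : Finset (EuclideanSpace ℝ (Fin m))}
    (hT : ∀ x, ‖x‖ ≤ 2 → ∃ y ∈ T, ‖x - y‖ < 1) (M : Matrix (Fin m) (Fin m) ℝ) {K : ℝ}
    (hK : 0 ≤ K) (h : ∀ x ∈ T, ∀ y ∈ T, y.ofLp ⬝ᵥ M *ᵥ x.ofLp ≤ K) : specNorm M ≤ K := by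
  set A := toEuclideanCLM (𝕜 := ℝ) M with hA
  have h1 : ∀ x ∈ T, ‖A x‖ ≤ K := by
    intro x hx
    rcases eq_or_ne (A x) 0 with h0 | h0
    · simpa [h0] using hK
    have hpos : 0 < ‖A x‖ := norm_pos_iff.2 h0
    obtain ⟨y, hy, hxy⟩ := hT ((2 / ‖A x‖) • A x) (by
      rw [norm_smul, Real.norm_of_nonneg (by positivity), div_mul_cancel₀ _ hpos.ne'])
    have h2 := h x hx y hy
    rw [dotProduct_mulVec_eq_inner] at h2
    change ⟪y, A x⟫ ≤ K at h2
    have h3 : ⟪(2 / ‖A x‖) • A x - y, A x⟫ ≤ ‖A x‖ := by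
      refine (real_inner_le_norm _ _).trans ?_
      nlinarith
    rw [inner_sub_left, real_inner_smul_left, real_inner_self_eq_norm_sq] at h3
    have h4 : 2 / ‖A x‖ * ‖A x‖ ^ 2 = 2 * ‖A x‖ := by field_simp
    linarith
  have hbound : ‖A‖ ≤ (K + ‖A‖) / 2 := by
    refine ContinuousLinearMap.opNorm_le_bound _ (by positivity) fun x => ?_
    rcases eq_or_ne x 0 with rfl | h0
    · simp
    have hpos : 0 < ‖x‖ := norm_pos_iff.2 h0
    obtain ⟨y, hy, hxy⟩ := hT ((2 / ‖x‖) • x) (by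
      rw [norm_smul, Real.norm_of_nonneg (by positivity), div_mul_cancel₀ _ hpos.ne'])
    have h2 : ‖A ((2 / ‖x‖) • x)‖ ≤ K + ‖A‖ := by
      calc _ = ‖A y + A ((2 / ‖x‖) • x - y)‖ := by rw [← map_add, add_sub_cancel]
        _ ≤ ‖A y‖ + ‖A ((2 / ‖x‖) • x - y)‖ := norm_add_le _ _
        _ ≤ K + ‖A‖ * ‖(2 / ‖x‖) • x - y‖ :=
          add_le_add (h1 y hy) (ContinuousLinearMap.le_opNorm _ _)
        _ ≤ _ := by nlinarith [norm_nonneg A]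
    rw [map_smul, norm_smul, Real.norm_of_nonneg (by positivity)] at h2
    have h3 : ‖A x‖ = ‖x‖ / 2 * (2 / ‖x‖ * ‖A x‖) := by field_simp
    rw [h3]
    nlinarith
  change ‖A‖ ≤ K
  linarith

/-- Moments of sub-Gaussian random variables. -/
lemma integral_pow_le_of_hasSubgaussianMGF {Ω : Type*} [MeasurableSpace Ω] {μ : Measure Ω}
    {Z : Ω → ℝ} {c : ℝ≥0} (hZ : HasSubgaussianMGF Z c μ) (hc : c ≤ 72) {k : ℕ} (hk : 1 ≤ k) :
    ∫ ω, Z ω ^ (2 * k) ∂μ ≤ 2 * (4 * Real.exp 36 * k) ^ k := by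
  have hk0 : (0 : ℝ) < k := by exact_mod_cast hk
  set t := Real.sqrt k
  have ht : t ^ 2 = k := Real.sq_sqrt hk0.le
  have hpt : ∀ z : ℝ, (k : ℝ) ^ k * z ^ (2 * k) ≤
      (2 * k).factorial * (Real.exp (t * z) + Real.exp (-t * z)) := by
    intro z
    have h1 := Real.pow_div_factorial_le_exp |t * z| (abs_nonneg _) (2 * k)
    have h2 : Real.exp |t * z| ≤ Real.exp (t * z) + Real.exp (-t * z) := by
      rcases abs_choice (t * z) with h | h <;> rw [h]
      · linarith [Real.exp_pos (-t * z)]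
      · rw [neg_mul]; linarith [Real.exp_pos (t * z)]
    rw [div_le_iff₀ (by positivity), pow_mul, sq_abs, ← pow_mul, mul_pow, pow_mul t, ht] at h1
    nlinarith [(2 * k).factorial_pos, (Nat.cast_pos (α := ℝ)).2 (2 * k).factorial_pos]
  have hexp : ∀ s : ℝ, s ^ 2 = k → mgf Z μ s ≤ Real.exp 36 ^ k := by
    intro s hs
    refine (hZ.mgf_le s).trans ?_
    rw [hs, ← Real.exp_nat_mul]
    refine Real.exp_le_exp.2 ?_
    have : (c : ℝ) ≤ 72 := by exact_mod_cast hc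
    nlinarith
  have h1 : (k : ℝ) ^ k * ∫ ω, Z ω ^ (2 * k) ∂μ ≤
      (2 * k).factorial * (2 * Real.exp 36 ^ k) := by
    rw [← integral_const_mul]
    calc _ ≤ ∫ ω, (2 * k).factorial * (Real.exp (t * Z ω) + Real.exp (-t * Z ω)) ∂μ := by
          refine integral_mono_of_nonneg (ae_of_all _ fun ω => ?_) ?_ (ae_of_all _ fun ω => hpt _)
          · have : 0 ≤ Z ω ^ (2 * k) := by rw [pow_mul]; positivity
            positivity
          · exact ((hZ.integrable_exp_mul t).add (hZ.integrable_exp_mul (-t))).const_mul _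
      _ = (2 * k).factorial * (mgf Z μ t + mgf Z μ (-t)) := by
          rw [integral_const_mul, integral_add (hZ.integrable_exp_mul t)
            (hZ.integrable_exp_mul (-t))]
          rfl
      _ ≤ _ := by
          gcongr
          rw [two_mul (Real.exp 36 ^ k)]
          exact add_le_add (hexp t ht) (hexp (-t) (by rw [neg_sq, ht]))
  have h2 : ((2 * k).factorial : ℝ) ≤ 4 ^ k * k ^ k * k ^ k := by
    calc ((2 * k).factorial : ℝ) ≤ (2 * k : ℕ) ^ (2 * k) := by exact_mod_cast Nat.factorial_le_pow _
      _ = _ := by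
        push_cast
        rw [show (4 : ℝ) = 2 ^ 2 by norm_num, ← pow_mul]
        ring
  have h3 : (0 : ℝ) < (k : ℝ) ^ k := by positivity
  refine le_of_mul_le_mul_left (h1.trans ?_) h3
  calc _ ≤ (4 : ℝ) ^ k * k ^ k * k ^ k * (2 * Real.exp 36 ^ k) := by gcongr
    _ = _ := by rw [mul_pow, mul_pow]; ring

end

section

open ProbabilityTheory Finset
open scoped NNReal RealInnerProductSpace

variable {m : ℕ}

lemma dotProduct_symMatrix_mulVec_eq (f : Fin m → Fin m → Bool → ℝ) (ω : Fin m → Fin m → Bool)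
    (x y : Fin m → ℝ) : y ⬝ᵥ symMatrix f ω *ᵥ x =
      ∑ e : Fin m × Fin m, (∑ p : Fin m × Fin m with (min p.1 p.2, max p.1 p.2) = e,
        y p.1 * x p.2) * f e.1 e.2 (ω e.1 e.2) := by
  have h1 : y ⬝ᵥ symMatrix f ω *ᵥ x = ∑ p : Fin m × Fin m, y p.1 * x p.2 *
      f (min p.1 p.2) (max p.1 p.2) (ω (min p.1 p.2) (max p.1 p.2)) := by
    rw [Fintype.sum_prod_type]
    simp only [dotProduct, mulVec, Finset.mul_sum]
    refine Finset.sum_congr rfl fun i _ => Finset.sum_congr rfl fun j _ => ?_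
    simp only [symMatrix, Matrix.of_apply]
    ring
  rw [h1, ← Finset.sum_fiberwise_of_maps_to (t := Finset.univ)
    (g := fun p : Fin m × Fin m => (min p.1 p.2, max p.1 p.2)) (by simp)]
  refine Finset.sum_congr rfl fun e _ => ?_
  rw [Finset.sum_mul]
  refine Finset.sum_congr rfl fun p hp => ?_
  rw [← (Finset.mem_filter.1 hp).2]

lemma sum_sq_fiber_le (x y : Fin m → ℝ) :
    ∑ e : Fin m × Fin m, (∑ p : Fin m × Fin m with (min p.1 p.2, max p.1 p.2) = e,
      y p.1 * x p.2) ^ 2 ≤ 2 * ((∑ i, y i ^ 2) * ∑ i, x i ^ 2) := by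
  have hcard (e : Fin m × Fin m) :
      #{p : Fin m × Fin m | (min p.1 p.2, max p.1 p.2) = e} ≤ 2 := by
    refine (Finset.card_le_card (t := {(e.1, e.2), (e.2, e.1)}) fun p hp => ?_).trans
      Finset.card_le_two
    obtain ⟨-, rfl⟩ := Finset.mem_filter.1 hp
    obtain ⟨i, j⟩ := p
    rcases le_total i j with h | h <;> simp [h]
  calc _ ≤ ∑ e : Fin m × Fin m, 2 *
        ∑ p : Fin m × Fin m with (min p.1 p.2, max p.1 p.2) = e, (y p.1 * x p.2) ^ 2 := by
        refine Finset.sum_le_sum fun e _ => sq_sum_le_card_mul_sum_sq.trans ?_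
        gcongr
        exact_mod_cast hcard e
    _ = 2 * ∑ p : Fin m × Fin m, (y p.1 * x p.2) ^ 2 := by
        rw [← Finset.mul_sum, Finset.sum_fiberwise_of_maps_to (by simp)]
    _ = _ := by
        rw [Finset.sum_mul_sum, Fintype.sum_prod_type]
        simp only [mul_pow]

lemma hasSubgaussianMGF_twoNegOneMatrix {x y : Fin m → ℝ} (hx : ∑ i, x i ^ 2 ≤ 4)
    (hy : ∑ i, y i ^ 2 ≤ 4) : ∃ c : ℝ≥0, c ≤ 72 ∧
      HasSubgaussianMGF (fun ω => y ⬝ᵥ twoNegOneMatrix ω *ᵥ x) c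
        (edgeMeasure fun _ _ => 1 / 3) := by
  have := isProbabilityMeasure_edgeMeasure (m := m) third_mem_Icc
  simp only [twoNegOneMatrix, dotProduct_symMatrix_mulVec_eq]
  set r : Fin m × Fin m → ℝ := fun e =>
    ∑ p : Fin m × Fin m with (min p.1 p.2, max p.1 p.2) = e, y p.1 * x p.2 with hr
  have hone (e : Fin m × Fin m) : HasSubgaussianMGF
      (fun ω : Fin m → Fin m → Bool => if ω e.1 e.2 then (2 : ℝ) else -1)
      ((‖(2 : ℝ) - -1‖₊ / 2) ^ 2) (edgeMeasure fun _ _ => 1 / 3) := by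
    refine hasSubgaussianMGF_of_mem_Icc_of_integral_eq_zero
      (measurable_of_finite _).aemeasurable (ae_of_all _ fun ω => ?_) ?_
    · split_ifs <;> constructor <;> norm_num
    · rw [integral_edge third_mem_Icc e.1 e.2 fun b => if b then (2 : ℝ) else -1]
      norm_num
  have hind := (iIndepFun_edge (m := m) third_mem_Icc).comp
    (fun e b => r e * if b then (2 : ℝ) else -1) fun e => measurable_of_finite _
  refine ⟨_, ?_, HasSubgaussianMGF.sum_of_iIndepFun hind (s := Finset.univ) fun e _ =>
    (hone e).const_mul (r e)⟩
  rw [← NNReal.coe_le_coe, NNReal.coe_sum]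
  change ∑ e, r e ^ 2 * (‖(2 : ℝ) - -1‖ / 2) ^ 2 ≤ 72
  rw [← Finset.sum_mul]
  have h1 : ∑ e, r e ^ 2 ≤ 2 * (4 * 4) := by
    refine (sum_sq_fiber_le x y).trans ?_
    gcongr
  have h2 : (‖(2 : ℝ) - -1‖ / 2) ^ 2 = 9 / 4 := by norm_num
  rw [h2]
  calc _ ≤ (2 * (4 * 4) : ℝ) * (9 / 4) := by gcongr
    _ = _ := by norm_num

lemma specNorm_pow_le_sum_net {T : Finset (EuclideanSpace ℝ (Fin m))}
    (hT : ∀ x, ‖x‖ ≤ 2 → ∃ y ∈ T, ‖x - y‖ < 1) (M : Matrix (Fin m) (Fin m) ℝ) {k : ℕ}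
    (hk : 1 ≤ k) :
    specNorm M ^ (2 * k) ≤ ∑ x ∈ T, ∑ y ∈ T, (y.ofLp ⬝ᵥ M *ᵥ x.ofLp) ^ (2 * k) := by
  set S := ∑ x ∈ T, ∑ y ∈ T, (y.ofLp ⬝ᵥ M *ᵥ x.ofLp) ^ (2 * k)
  have hnn (z : ℝ) : 0 ≤ z ^ (2 * k) := by rw [pow_mul]; positivity
  have hS : 0 ≤ S := Finset.sum_nonneg fun x _ => Finset.sum_nonneg fun y _ => hnn _
  have hk0 : 2 * k ≠ 0 := by lia
  set K := S ^ (((2 * k : ℕ) : ℝ)⁻¹)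
  have hK : K ^ (2 * k) = S := Real.rpow_inv_natCast_pow hS hk0
  have hK0 : 0 ≤ K := Real.rpow_nonneg hS _
  rw [← hK]
  refine pow_le_pow_left₀ (specNorm_nonneg M) (specNorm_le_of_net hT M hK0 fun x hx y hy => ?_) _
  refine (le_abs_self _).trans ((pow_le_pow_iff_left₀ (abs_nonneg _) hK0 hk0).1 ?_)
  rw [hK, (even_two_mul k).pow_abs]
  refine (Finset.single_le_sum (f := fun y : EuclideanSpace ℝ (Fin m) =>
    (y.ofLp ⬝ᵥ M *ᵥ x.ofLp) ^ (2 * k)) (fun y _ => hnn _) hy).trans ?_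
  exact Finset.single_le_sum (f := fun x : EuclideanSpace ℝ (Fin m) =>
    ∑ y ∈ T, (y.ofLp ⬝ᵥ M *ᵥ x.ofLp) ^ (2 * k))
    (fun x _ => Finset.sum_nonneg fun y _ => hnn _) hx

lemma integral_specNorm_twoNegOneMatrix_le {k : ℕ} (hk : 1 ≤ k) :
    ∫ ω, specNorm (twoNegOneMatrix ω) ^ (2 * k) ∂(edgeMeasure (m := m) fun _ _ => 1 / 3) ≤
      25 ^ m * (2 * (4 * Real.exp 36 * k) ^ k) := by
  have := isProbabilityMeasure_edgeMeasure (m := m) third_mem_Icc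
  obtain ⟨T, hcard, hT2, hT⟩ := exists_finset_net (E := EuclideanSpace ℝ (Fin m))
  have hnorm : ∀ x ∈ T, ∑ i, x.ofLp i ^ 2 ≤ 4 := by
    intro x hx
    have h1 := EuclideanSpace.norm_sq_eq x
    simp only [Real.norm_eq_abs, sq_abs] at h1
    rw [← h1]
    nlinarith [norm_nonneg x, hT2 x hx]
  calc _ ≤ ∫ ω, ∑ x ∈ T, ∑ y ∈ T, (y.ofLp ⬝ᵥ twoNegOneMatrix ω *ᵥ x.ofLp) ^ (2 * k)
          ∂(edgeMeasure (m := m) fun _ _ => 1 / 3) :=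
        integral_mono .of_finite .of_finite fun ω => specNorm_pow_le_sum_net hT _ hk
    _ = ∑ x ∈ T, ∑ y ∈ T, ∫ ω, (y.ofLp ⬝ᵥ twoNegOneMatrix ω *ᵥ x.ofLp) ^ (2 * k)
          ∂(edgeMeasure (m := m) fun _ _ => 1 / 3) := by
        rw [integral_finsetSum _ fun _ _ => .of_finite]
        refine Finset.sum_congr rfl fun x _ => ?_
        rw [integral_finsetSum _ fun _ _ => .of_finite]
    _ ≤ ∑ x ∈ T, ∑ y ∈ T, 2 * (4 * Real.exp 36 * k) ^ k := by
        refine Finset.sum_le_sum fun x hx => Finset.sum_le_sum fun y hy => ?_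
        obtain ⟨c, hc, hsub⟩ := hasSubgaussianMGF_twoNegOneMatrix (hnorm x hx) (hnorm y hy)
        exact integral_pow_le_of_hasSubgaussianMGF hsub hc hk
    _ = (#T * #T : ℝ) * (2 * (4 * Real.exp 36 * k) ^ k) := by
        simp only [Finset.sum_const, nsmul_eq_mul]
        ring
    _ ≤ _ := by
        rw [finrank_euclideanSpace_fin] at hcard
        have h5 : (#T : ℝ) ≤ 5 ^ m := by exact_mod_cast hcard
        have h25 : (25 : ℝ) ^ m = 5 ^ m * 5 ^ m := by rw [← mul_pow]; norm_num
        rw [h25]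
        gcongr

/-- A universal constant governing the size of random symmetric matrices. -/
noncomputable def momentConst : ℝ := 25 ^ 3 * (4 * Real.exp 36)

lemma momentConst_pos : 0 < momentConst := by unfold momentConst; positivity

lemma card_repeatingWalk_three_mul_le {k : ℕ} (hk : 1 ≤ k) :
    (#{w : Fin (2 * k + 1) → Fin (3 * k) | IsRepeatingWalk w} : ℝ) ≤
      6 * k * (momentConst * k) ^ k := by
  have := isProbabilityMeasure_edgeMeasure (m := 3 * k) third_mem_Icc
  calc _ ≤ ∫ ω, (twoNegOneMatrix ω ^ (2 * k)).trace
          ∂(edgeMeasure (m := 3 * k) fun _ _ => 1 / 3) := card_repeatingWalk_le (2 * k)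
    _ ≤ ∫ ω, ((3 * k : ℕ) : ℝ) * specNorm (twoNegOneMatrix ω) ^ (2 * k)
          ∂(edgeMeasure (m := 3 * k) fun _ _ => 1 / 3) :=
        integral_mono .of_finite .of_finite fun ω => trace_pow_le _ _
    _ ≤ ((3 * k : ℕ) : ℝ) * (25 ^ (3 * k) * (2 * (4 * Real.exp 36 * k) ^ k)) := by
        rw [integral_const_mul]
        gcongr
        exact integral_specNorm_twoNegOneMatrix_le hk
    _ = _ := by
        rw [momentConst, pow_mul, mul_assoc (25 ^ 3 : ℝ), mul_pow (25 ^ 3 : ℝ)]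
        push_cast
        ring

/-- Concentration of the spectral norm of a centered random adjacency matrix. -/
lemma measure_specNorm_centeredAdj_le {P : Fin m → Fin m → ℝ}
    (hP : ∀ i j, P i j ∈ Set.Icc (0 : ℝ) 1) {q : ℝ} (hPq : ∀ i j, P i j ≤ q) (hq : q ≤ 1)
    (hm : 1 ≤ m) (hmq : 1 ≤ m * q) {n : ℕ} (hn : m * q ≤ 2 * 2 ^ n) :
    (edgeMeasure P).real {ω | Real.exp 1 * momentConst * 2 ^ n ≤ specNorm (centeredAdj P ω) ^ 2} ≤
      6 * m * 2 ^ n * Real.exp (-2 ^ n) := by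
  have := isProbabilityMeasure_edgeMeasure hP
  set k : ℕ := 2 ^ n with hk
  have hkpos : 1 ≤ k := Nat.one_le_two_pow
  have hkcast : (2 : ℝ) ^ n = k := by simp [hk]
  rw [hkcast] at hn ⊢
  have hB := momentConst_pos
  have hk0 : (0 : ℝ) < k := by exact_mod_cast hkpos
  have hq0 : 0 ≤ q := by
    by_contra! h
    have : (m : ℝ) * q ≤ 0 := mul_nonpos_of_nonneg_of_nonpos (by positivity) h.le
    linarith
  have hmoment : ∫ ω, specNorm (centeredAdj P ω) ^ (2 * k) ∂(edgeMeasure P) ≤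
      m * (6 * k * (momentConst * k) ^ k) := by
    calc _ ≤ ∫ ω, (centeredAdj P ω ^ (2 * k)).trace ∂(edgeMeasure P) :=
          integral_mono .of_finite .of_finite fun ω =>
            specNorm_pow_le_trace (isSymm_symMatrix _ ω) n
      _ ≤ _ := integral_trace_pow_centeredAdj_le hP hPq (2 * k)
      _ ≤ _ := sum_repeatingWalk_le (r := 3 * k) hq0 hq hm hmq (by push_cast; linarith)
      _ ≤ _ := by
          gcongr
          exact card_repeatingWalk_three_mul_le hkpos
  have hmarkov := mul_meas_ge_le_integral_of_nonneg (μ := edgeMeasure P)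
    (f := fun ω => specNorm (centeredAdj P ω) ^ (2 * k))
    (ae_of_all _ fun ω => pow_nonneg (specNorm_nonneg _) _) .of_finite
    ((Real.exp 1 * momentConst * k) ^ k)
  have hsub : (edgeMeasure P).real
      {ω | Real.exp 1 * momentConst * k ≤ specNorm (centeredAdj P ω) ^ 2} ≤
      (edgeMeasure P).real {ω | (Real.exp 1 * momentConst * k) ^ k ≤
        specNorm (centeredAdj P ω) ^ (2 * k)} := by
    refine measureReal_mono fun ω hω => ?_
    simp only [Set.mem_ofPred_eq] at hω ⊢
    rw [pow_mul]
    exact pow_le_pow_left₀ (by positivity) hω _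
  refine hsub.trans ?_
  have hpos : 0 < (Real.exp 1 * momentConst * k) ^ k := by positivity
  refine le_of_mul_le_mul_left (hmarkov.trans (hmoment.trans_eq ?_)) hpos
  have he : Real.exp 1 ^ k * Real.exp (-k) = 1 := by
    rw [← Real.exp_nat_mul, ← Real.exp_add]; simp
  rw [mul_assoc (Real.exp 1), mul_pow (Real.exp 1)]
  linear_combination -(m * 6 * k * (momentConst * k) ^ k) * he

end

section

open ProbabilityTheory Finset

variable {m : ℕ}

lemma adjOf_apply (ω : Fin m → Fin m → Bool) (i j : Fin m) :
    adjOf ω i j = if ω (min i j) (max i j) then 1 else 0 := by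
  rw [adjOf, Matrix.of_apply]
  rcases lt_or_ge j i with h | h
  · rw [if_neg h.not_ge, min_eq_right h.le, max_eq_left h.le]
  · rw [if_pos h, min_eq_left h, max_eq_right h]

lemma isSymm_adjOf (ω : Fin m → Fin m → Bool) : (adjOf ω).IsSymm := by
  ext i j
  simp only [transpose_apply, adjOf_apply, min_comm, max_comm]

lemma adjOf_nonneg (ω : Fin m → Fin m → Bool) (i j : Fin m) : 0 ≤ adjOf ω i j := by
  rw [adjOf_apply]; split_ifs <;> norm_num

section

variable {P : Fin m → Fin m → ℝ} (hP : ∀ i j, P i j ∈ Set.Icc (0 : ℝ) 1)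
include hP

lemma integral_prod_edge {ι : Type*} [Fintype ι] {e : ι → Fin m × Fin m}
    (he : Function.Injective e) (g : Bool → ℝ) :
    ∫ ω, ∏ t, g (ω (e t).1 (e t).2) ∂(edgeMeasure P) =
      ∏ t, (P (e t).1 (e t).2 * g true + (1 - P (e t).1 (e t).2) * g false) := by
  refine (iIndepFun.integral_fun_prod_eq_prod_integral
    (((iIndepFun_edge hP).precomp he).comp (fun _ => g) fun _ => measurable_of_finite _)
    fun _ => (measurable_of_finite _).aestronglyMeasurable).trans ?_
  exact Finset.prod_congr rfl fun t _ => integral_edge hP _ _ g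

variable (hPs : ∀ i j, P i j = P j i)
include hPs

omit hP in
lemma apply_min_max (i j : Fin m) : P (min i j) (max i j) = P i j := by
  rcases le_total i j with h | h
  · rw [min_eq_left h, max_eq_right h]
  · rw [min_eq_right h, max_eq_left h, hPs]

lemma measure_deg_le (i : Fin m) :
    (edgeMeasure P).real {ω | deg ω i ≤ (∑ j, P i j) / 8} ≤ Real.exp (-(∑ j, P i j) / 2) := by
  have := isProbabilityMeasure_edgeMeasure hP
  set s := ∑ j, P i j with hs
  have hs0 : 0 ≤ s := Finset.sum_nonneg fun j _ => (hP i j).1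
  have hinj : Function.Injective fun j : Fin m => ((min i j, max i j) : Fin m × Fin m) := by
    intro j j' h
    have := min_max_eq_iff.1 h
    rw [Sym2.eq_iff] at this
    grind
  have he1 : Real.exp (-1) ≤ 3 / 8 := by
    rw [Real.exp_neg, inv_le_comm₀ (Real.exp_pos _) (by norm_num)]
    linarith [Real.exp_one_gt_d9]
  have hmoment : ∫ ω, Real.exp (-deg ω i) ∂(edgeMeasure P) ≤ Real.exp (-(5 / 8) * s) := by
    have h1 (ω : Fin m → Fin m → Bool) : Real.exp (-deg ω i) =
        ∏ j, (fun b : Bool => if b then Real.exp (-1) else 1) (ω (min i j) (max i j)) := by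
      rw [deg, ← Finset.sum_neg_distrib, Real.exp_sum]
      refine Finset.prod_congr rfl fun j _ => ?_
      rw [adjOf_apply]
      split_ifs with h <;> simp [h]
    simp_rw [h1]
    refine (integral_prod_edge hP hinj fun b => if b then Real.exp (-1) else 1).trans_le ?_
    rw [hs, Finset.mul_sum, Real.exp_sum]
    refine Finset.prod_le_prod (fun j _ => ?_) fun j _ => ?_
    · have := hP (min i j) (max i j)
      have h2 := Real.exp_pos (-1)
      simp only [if_true, Bool.false_eq_true, if_false]
      have := mul_nonneg this.1 h2.le
      linarith [(hP (min i j) (max i j)).2]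
    · simp only [if_true, Bool.false_eq_true, if_false, apply_min_max hPs]
      have h3 := Real.add_one_le_exp (-(5 / 8) * P i j)
      nlinarith [(hP i j).1]
  have hmarkov := mul_meas_ge_le_integral_of_nonneg (μ := edgeMeasure P)
    (f := fun ω => Real.exp (-deg ω i)) (ae_of_all _ fun ω => (Real.exp_pos _).le) .of_finite
    (Real.exp (-(s / 8)))
  simp only [Real.exp_le_exp, neg_le_neg_iff] at hmarkov
  refine le_of_mul_le_mul_left ((hmarkov.trans hmoment).trans ?_) (Real.exp_pos (-(s / 8)))
  rw [← Real.exp_add, Real.exp_le_exp]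
  linarith

lemma measure_forall_adjOf_eq_zero_le {S T : Finset (Fin m)} (hST : Disjoint S T) :
    (edgeMeasure P).real {ω | ∀ i ∈ S, ∀ j ∈ T, adjOf ω i j = 0} ≤
      Real.exp (-∑ i ∈ S, ∑ j ∈ T, P i j) := by
  have := isProbabilityMeasure_edgeMeasure hP
  let e : (S ×ˢ T : Finset (Fin m × Fin m)) → Fin m × Fin m :=
    fun t => (min t.1.1 t.1.2, max t.1.1 t.1.2)
  have hinj : Function.Injective e := by
    rintro ⟨⟨i, j⟩, h⟩ ⟨⟨i', j'⟩, h'⟩ heq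
    rw [Finset.mem_product] at h h'
    have h2 := min_max_eq_iff.1 heq
    rw [Sym2.eq_iff] at h2
    rcases h2 with ⟨rfl, rfl⟩ | ⟨rfl, rfl⟩
    · rfl
    · exact absurd h'.2 (Finset.disjoint_left.1 hST h.1)
  set g : Bool → ℝ := fun b => if b then 0 else 1 with hg
  have hg0 (b : Bool) : 0 ≤ g b := by cases b <;> simp [hg]
  have hmarkov := mul_meas_ge_le_integral_of_nonneg (μ := edgeMeasure P)
    (f := fun ω => ∏ t, g (ω (e t).1 (e t).2))
    (ae_of_all _ fun ω => Finset.prod_nonneg fun t _ => hg0 _) .of_finite 1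
  rw [one_mul, integral_prod_edge hP hinj] at hmarkov
  refine (measureReal_mono fun ω hω => ?_).trans (hmarkov.trans ?_)
  · refine (Finset.prod_eq_one (f := fun t => g (ω (e t).1 (e t).2)) fun t _ => ?_).ge
    have h1 := hω t.1.1 (Finset.mem_product.1 t.2).1 t.1.2 (Finset.mem_product.1 t.2).2
    rw [adjOf_apply] at h1
    have h2 : ω (e t).1 (e t).2 = false := by
      by_contra h
      rw [Bool.not_eq_false] at h
      rw [if_pos h] at h1
      exact one_ne_zero h1
    rw [h2]
    simp [hg]
  · rw [← Finset.sum_product' S T P, ← Finset.sum_neg_distrib, Real.exp_sum,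
      ← Finset.prod_coe_sort (S ×ˢ T)]
    refine Finset.prod_le_prod (fun t _ => ?_) fun t _ => ?_
    · have := hP (e t).1 (e t).2
      simp only [hg, if_true, Bool.false_eq_true, if_false]
      linarith [this.2]
    · simp only [hg, if_true, Bool.false_eq_true, if_false, e, apply_min_max hPs]
      linarith [Real.add_one_le_exp (-P t.1.1 t.1.2)]

lemma measure_exists_cut_le {W : Finset (Fin m)} {p x : ℝ} (hp : 0 ≤ p)
    (hW : ∀ i ∈ W, ∀ j ∈ W, p ≤ P i j)
    (hx : x = Real.exp (-(p * #W / 2))) (hx1 : #W * x ≤ 1) :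
    (edgeMeasure P).real {ω | ∃ S ⊆ W, S.Nonempty ∧ S ≠ W ∧
      ∀ i ∈ S, ∀ j ∈ W \ S, adjOf ω i j = 0} ≤ 4 * (#W * x) := by
  have := isProbabilityMeasure_edgeMeasure hP
  have hx0 : 0 < x := hx ▸ Real.exp_pos _
  have hsub : {ω : Fin m → Fin m → Bool | ∃ S ⊆ W, S.Nonempty ∧ S ≠ W ∧
      ∀ i ∈ S, ∀ j ∈ W \ S, adjOf ω i j = 0} ⊆
      ⋃ S ∈ W.powerset.filter fun S => S.Nonempty ∧ S ≠ W,
        {ω | ∀ i ∈ S, ∀ j ∈ W \ S, adjOf ω i j = 0} := by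
    rintro ω ⟨S, hS, hne, hneW, h⟩
    simp only [Set.mem_iUnion]
    exact ⟨S, by simp [hS, hne, hneW], h⟩
  have hterm : ∀ S ∈ W.powerset.filter fun S => S.Nonempty ∧ S ≠ W,
      (edgeMeasure P).real {ω | ∀ i ∈ S, ∀ j ∈ W \ S, adjOf ω i j = 0} ≤
        x ^ #S + x ^ (#W - #S) := by
    intro S hS
    have hSW : S ⊆ W := Finset.mem_powerset.1 (Finset.mem_filter.1 hS).1
    refine (measure_forall_adjOf_eq_zero_le hP hPs disjoint_sdiff).trans ?_
    have h1 : (#S : ℝ) * ((#W - #S : ℕ) : ℝ) * p ≤ ∑ i ∈ S, ∑ j ∈ W \ S, P i j := by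
      rw [← Finset.card_sdiff_of_subset hSW]
      calc _ = ∑ i ∈ S, ∑ j ∈ W \ S, p := by simp [mul_assoc]
        _ ≤ _ := Finset.sum_le_sum fun i hi => Finset.sum_le_sum fun j hj =>
          hW i (hSW hi) j (Finset.mem_sdiff.1 hj).1
    have hle := Finset.card_le_card hSW
    have hcast : ((#W - #S : ℕ) : ℝ) = #W - #S := by rw [Nat.cast_sub hle]
    have hleR : (#S : ℝ) ≤ #W := by exact_mod_cast hle
    have hS0 : (0 : ℝ) ≤ #S := Nat.cast_nonneg _
    rcases le_total (2 * (#S : ℝ)) #W with h | h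
    · have h2 : Real.exp (-∑ i ∈ S, ∑ j ∈ W \ S, P i j) ≤ x ^ #S := by
        rw [hx, ← Real.exp_nat_mul, Real.exp_le_exp]
        rw [hcast] at h1
        have : 0 ≤ p * (#S * (#W - 2 * #S)) := by
          have : 0 ≤ (#W : ℝ) - 2 * #S := by linarith
          positivity
        nlinarith
      linarith [pow_pos hx0 (#W - #S)]
    · have h2 : Real.exp (-∑ i ∈ S, ∑ j ∈ W \ S, P i j) ≤ x ^ (#W - #S) := by
        rw [hx, ← Real.exp_nat_mul, Real.exp_le_exp]
        rw [hcast] at h1 ⊢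
        have : 0 ≤ p * ((#W - #S) * (2 * #S - #W)) := by
          have h3 : 0 ≤ (#W : ℝ) - #S := by linarith
          have h4 : 0 ≤ 2 * #S - (#W : ℝ) := by linarith
          positivity
        nlinarith
      linarith [pow_pos hx0 #S]
  have hbin : (1 + x) ^ #W - 1 ≤ 2 * (#W * x) := by
    have h1 : (1 + x) ^ #W ≤ Real.exp (#W * x) := by
      rw [Real.exp_nat_mul]
      gcongr
      linarith [Real.add_one_le_exp x]
    have h0 : 0 ≤ #W * x := by positivity
    have h2 := Real.abs_exp_sub_one_le (x := #W * x) (by rwa [abs_of_nonneg h0])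
    rw [abs_of_nonneg h0] at h2
    linarith [le_abs_self (Real.exp (#W * x) - 1)]
  have hsum1 : ∑ S ∈ W.powerset.filter (fun S => S.Nonempty ∧ S ≠ W), x ^ #S ≤
      (1 + x) ^ #W - 1 := by
    have h1 := Finset.sum_pow_mul_eq_add_pow x 1 W
    simp only [one_pow, mul_one] at h1
    rw [add_comm 1 x, ← h1, ← Finset.sum_erase_add _ _ (Finset.empty_mem_powerset W)]
    simp only [Finset.card_empty, pow_zero, add_sub_cancel_right]
    refine Finset.sum_le_sum_of_subset_of_nonneg (fun S hS => ?_) fun S _ _ => by positivity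
    rw [Finset.mem_filter] at hS
    exact Finset.mem_erase.2 ⟨hS.2.1.ne_empty, hS.1⟩
  have hsum2 : ∑ S ∈ W.powerset.filter (fun S => S.Nonempty ∧ S ≠ W), x ^ (#W - #S) ≤
      (1 + x) ^ #W - 1 := by
    have h1 := Finset.sum_pow_mul_eq_add_pow 1 x W
    simp only [one_pow, one_mul] at h1
    rw [← h1, ← Finset.sum_erase_add _ _ (Finset.mem_powerset_self W)]
    simp only [Nat.sub_self, pow_zero, add_sub_cancel_right]
    refine Finset.sum_le_sum_of_subset_of_nonneg (fun S hS => ?_) fun S _ _ => by positivity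
    rw [Finset.mem_filter] at hS
    exact Finset.mem_erase.2 ⟨hS.2.2, hS.1⟩
  calc _ ≤ _ := measureReal_mono hsub (measure_ne_top _ _)
    _ ≤ _ := measureReal_biUnion_finset_le _ _
    _ ≤ _ := Finset.sum_le_sum hterm
    _ ≤ _ := by
      rw [Finset.sum_add_distrib]
      linarith

end

lemma eq_of_forall_cut {W : Finset (Fin m)} {ω : Fin m → Fin m → Bool}
    (hω : ¬∃ S ⊆ W, S.Nonempty ∧ S ≠ W ∧ ∀ i ∈ S, ∀ j ∈ W \ S, adjOf ω i j = 0)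
    {u : Fin m → ℝ} (hu : ∀ i j, adjOf ω i j ≠ 0 → u i = u j) {i j : Fin m} (hi : i ∈ W)
    (hj : j ∈ W) : u i = u j := by
  by_contra hne
  refine hω ⟨W.filter fun l => u l = u i, Finset.filter_subset _ _, ⟨i, by simp [hi]⟩, ?_, ?_⟩
  · intro h
    rw [← h, Finset.mem_filter] at hj
    exact hne hj.2.symm
  · intro k hk l hl
    by_contra h
    simp only [Finset.mem_filter, Finset.mem_sdiff, not_and] at hk hl
    exact hl.2 hl.1 ((hu k l h).symm.trans hk.2)

end

section

open ProbabilityTheory Finset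
open scoped RealInnerProductSpace

variable {m : ℕ}

/-- The Euclidean norm of a coordinate vector. -/
noncomputable def l2 (u : Fin m → ℝ) : ℝ := ‖WithLp.toLp 2 u‖

section L2

lemma l2_nonneg (u : Fin m → ℝ) : 0 ≤ l2 u := norm_nonneg _

lemma l2_sq (u : Fin m → ℝ) : l2 u ^ 2 = ∑ i, u i ^ 2 := by
  rw [l2, EuclideanSpace.norm_sq_eq]
  simp

lemma dotProduct_self_eq (u : Fin m → ℝ) : u ⬝ᵥ u = l2 u ^ 2 := by
  rw [l2_sq]
  simp only [dotProduct, sq]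

lemma abs_dotProduct_le (u v : Fin m → ℝ) : |u ⬝ᵥ v| ≤ l2 u * l2 v := by
  have h := abs_real_inner_le_norm (WithLp.toLp 2 v) (WithLp.toLp 2 u)
  rw [EuclideanSpace.inner_toLp_toLp] at h
  rw [mul_comm]
  exact h

lemma l2_le_of_sum_sq_le {u : Fin m → ℝ} {K : ℝ} (hK : 0 ≤ K) (h : ∑ i, u i ^ 2 ≤ K ^ 2) :
    l2 u ≤ K := by
  rw [← l2_sq] at h
  exact (pow_le_pow_iff_left₀ (l2_nonneg u) hK two_ne_zero).1 h

lemma l2_mulVec_le (M : Matrix (Fin m) (Fin m) ℝ) (v : Fin m → ℝ) :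
    l2 (M *ᵥ v) ≤ specNorm M * l2 v :=
  ContinuousLinearMap.le_opNorm (toEuclideanCLM (𝕜 := ℝ) M) (WithLp.toLp 2 v)

lemma abs_dotProduct_mulVec_le (M : Matrix (Fin m) (Fin m) ℝ) (u v : Fin m → ℝ) :
    |u ⬝ᵥ M *ᵥ v| ≤ specNorm M * (l2 u * l2 v) := by
  refine (abs_dotProduct_le _ _).trans ?_
  have := mul_le_mul_of_nonneg_left (l2_mulVec_le M v) (l2_nonneg u)
  linarith

lemma l2_mul_le {g u : Fin m → ℝ} {K : ℝ} (hK : 0 ≤ K) (hg : ∀ i, g i ^ 2 ≤ K ^ 2) :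
    l2 (fun i => g i * u i) ≤ K * l2 u := by
  refine l2_le_of_sum_sq_le (mul_nonneg hK (l2_nonneg u)) ?_
  rw [mul_pow, l2_sq, Finset.mul_sum]
  refine Finset.sum_le_sum fun i _ => ?_
  rw [mul_pow]
  exact mul_le_mul_of_nonneg_right (hg i) (sq_nonneg _)

end L2

section Spectral

variable {M : Matrix (Fin m) (Fin m) ℝ} {s : Fin m → ℝ}

lemma dotProduct_mulVec_comm_of_isSymm (hM : M.IsSymm) (x y : Fin m → ℝ) :
    x ⬝ᵥ M *ᵥ y = y ⬝ᵥ M *ᵥ x := by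
  rw [dotProduct_mulVec, ← mulVec_transpose, hM.eq, dotProduct_comm]

/-- If `1` is the top eigenvalue of a symmetric matrix and it is simple with eigenvector `s`, then
the second eigenvector is orthogonal to `s` and the second eigenvalue dominates the quadratic form
on the orthogonal complement of `s`. -/
lemma second_eigenvalue_of_simple_top (hH : M.IsHermitian) (hs : M *ᵥ s = s)
    (hs0 : s ≠ 0) (hle : ∀ x, x ⬝ᵥ M *ᵥ x ≤ x ⬝ᵥ x) (hsimple : ∀ x, M *ᵥ x = x → ∃ c : ℝ, x = c • s)
    {lam : Fin m → ℝ} {σ : Equiv.Perm (Fin m)} (hlam : lam = hH.eigenvalues ∘ σ)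
    (hanti : Antitone lam) {i : Fin m} (hi : i.val = 1) :
    (∀ w, M *ᵥ w = lam i • w → w ⬝ᵥ s = 0) ∧
      ∀ y, y ⬝ᵥ s = 0 → y ⬝ᵥ M *ᵥ y ≤ lam i * (y ⬝ᵥ y) := by
  have hsymm : M.IsSymm := by
    have := hH
    rwa [Matrix.IsHermitian, conjTranspose_eq_transpose_of_trivial] at this
  let b := hH.eigenvectorBasis
  let v : Fin m → Fin m → ℝ := fun k => (b (σ k)).ofLp
  have hv : ∀ k, M *ᵥ v k = lam k • v k := fun k => by
    rw [hlam]
    exact hH.mulVec_eigenvectorBasis (σ k)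
  have hinner : ∀ x y : EuclideanSpace ℝ (Fin m), ⟪x, y⟫ = x.ofLp ⬝ᵥ y.ofLp := fun x y => by
    rw [EuclideanSpace.inner_eq_star_dotProduct, star_trivial, dotProduct_comm]
  have hunit : ∀ k, v k ⬝ᵥ v k = 1 := fun k => by
    have h := b.orthonormal.1 (σ k)
    rw [← hinner, real_inner_self_eq_norm_sq, h, one_pow]
  have horth : ∀ k l, k ≠ l → v k ⬝ᵥ v l = 0 := fun k l hkl => by
    rw [← hinner]
    exact b.orthonormal.2 (σ.injective.ne hkl)
  have hparseval : ∀ x y : Fin m → ℝ, x ⬝ᵥ y = ∑ k, (v k ⬝ᵥ x) * (v k ⬝ᵥ y) := fun x y => by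
    have h := b.sum_inner_mul_inner (WithLp.toLp 2 x) (WithLp.toLp 2 y)
    rw [hinner] at h
    rw [← h, ← Equiv.sum_comp σ]
    refine Finset.sum_congr rfl fun k _ => ?_
    rw [hinner, hinner, dotProduct_comm x]
  have hcoef : ∀ x k, v k ⬝ᵥ M *ᵥ x = lam k * (v k ⬝ᵥ x) := fun x k => by
    rw [dotProduct_mulVec_comm_of_isSymm hsymm, hv, dotProduct_smul, smul_eq_mul, dotProduct_comm]
  have hlam1 : ∀ k, lam k ≤ 1 := fun k => by
    have h := hle (v k)
    rwa [hcoef, hunit, mul_one] at h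
  have hvs : ∀ k, lam k = 1 → ∃ c : ℝ, v k = c • s := fun k hk => hsimple _ (by
    rw [hv, hk, one_smul])
  have hmpos : 0 < m := i.pos
  let i0 : Fin m := ⟨0, hmpos⟩
  have hlam0 : lam i0 = 1 := by
    obtain ⟨k, hk⟩ : ∃ k, v k ⬝ᵥ s ≠ 0 := by
      by_contra! h
      refine hs0 (dotProduct_self_eq_zero.1 ?_)
      rw [hparseval]
      exact Finset.sum_eq_zero fun k _ => by rw [h, mul_zero]
    have h1 := hcoef s k
    rw [hs] at h1
    have h2 : lam k = 1 := by
      have : (lam k - 1) * (v k ⬝ᵥ s) = 0 := by linarith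
      rcases mul_eq_zero.1 this with h | h
      · linarith
      · exact absurd h hk
    refine le_antisymm (hlam1 i0) (h2.ge.trans (hanti ?_))
    exact Nat.zero_le _
  have hi0 : i0 ≠ i := fun h => by
    rw [← h] at hi
    exact zero_ne_one hi
  obtain ⟨c, hc⟩ := hvs i0 hlam0
  have hc0 : c ≠ 0 := by
    rintro rfl
    have := hunit i0
    rw [hc, zero_smul, zero_dotProduct] at this
    exact zero_ne_one this
  have hlami : lam i ≠ 1 := fun h => by
    obtain ⟨c', hc'⟩ := hvs i h
    have h1 := horth _ _ hi0
    have h2 := hunit i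
    rw [hc, hc', smul_dotProduct, dotProduct_smul, smul_eq_mul, smul_eq_mul] at h1
    rw [hc', smul_dotProduct, dotProduct_smul, smul_eq_mul, smul_eq_mul] at h2
    have h3 : c' * (s ⬝ᵥ s) = 0 := (mul_eq_zero.1 h1).resolve_left hc0
    rw [h3, mul_zero] at h2
    exact zero_ne_one h2
  refine ⟨fun w hw => ?_, fun y hy => ?_⟩
  · have h1 := dotProduct_mulVec_comm_of_isSymm hsymm s w
    rw [hs, hw, dotProduct_smul, smul_eq_mul, dotProduct_comm s w] at h1
    have : (lam i - 1) * (w ⬝ᵥ s) = 0 := by linarith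
    exact (mul_eq_zero.1 this).resolve_left (sub_ne_zero.2 hlami)
  · rw [hparseval y (M *ᵥ y), hparseval y y, Finset.mul_sum]
    refine Finset.sum_le_sum fun k _ => ?_
    rw [hcoef]
    rcases eq_or_ne k i0 with rfl | hk
    · rw [hc, smul_dotProduct, dotProduct_comm s y, hy, smul_zero]
      simp
    · have h1 : lam k ≤ lam i := hanti (by
        rw [Fin.le_def, hi]
        exact Nat.one_le_iff_ne_zero.2 fun h => hk (Fin.ext h))
      nlinarith [mul_self_nonneg (v k ⬝ᵥ y)]

end Spectral

section NormAdj

variable {ω : Fin m → Fin m → Bool}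

lemma dotProduct_normAdj_mulVec (u v : Fin m → ℝ) : u ⬝ᵥ normAdj ω *ᵥ v =
    (fun i => (√(deg ω i))⁻¹ * u i) ⬝ᵥ adjOf ω *ᵥ fun i => (√(deg ω i))⁻¹ * v i := by
  rw [normAdj, ← mulVec_mulVec, ← mulVec_mulVec]
  have h : ∀ x : Fin m → ℝ, (diagonal fun i => (√(deg ω i))⁻¹) *ᵥ x =
      fun i => (√(deg ω i))⁻¹ * x i := fun x => funext fun i => mulVec_diagonal _ _ _
  rw [h, h]
  simp only [dotProduct]
  refine Finset.sum_congr rfl fun i _ => ?_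
  ring

lemma normAdj_mulVec_sqrt_deg (hdeg : ∀ i, 0 < deg ω i) :
    (normAdj ω *ᵥ fun i => √(deg ω i)) = fun i => √(deg ω i) := by
  rw [normAdj, ← mulVec_mulVec, ← mulVec_mulVec]
  have h1 : ((diagonal fun i => (√(deg ω i))⁻¹) *ᵥ fun i => √(deg ω i)) = fun _ => 1 := by
    funext i
    rw [mulVec_diagonal]
    exact inv_mul_cancel₀ (Real.sqrt_ne_zero'.2 (hdeg i))
  funext i
  rw [h1, mulVec_diagonal]
  have h2 : (adjOf ω *ᵥ fun _ => 1) i = deg ω i := by simp [mulVec, dotProduct, deg]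
  rw [h2]
  have h3 := Real.mul_self_sqrt (hdeg i).le
  have h4 : √(deg ω i) ≠ 0 := Real.sqrt_ne_zero'.2 (hdeg i)
  field_simp
  linarith

lemma dotProduct_sub_normAdj (hdeg : ∀ i, 0 < deg ω i) (x : Fin m → ℝ) :
    x ⬝ᵥ x - x ⬝ᵥ normAdj ω *ᵥ x = 1 / 2 * ∑ i, ∑ j, adjOf ω i j *
      ((√(deg ω i))⁻¹ * x i - (√(deg ω j))⁻¹ * x j) ^ 2 := by
  rw [dotProduct_normAdj_mulVec]
  set y : Fin m → ℝ := fun i => (√(deg ω i))⁻¹ * x i with hy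
  have h1 : x ⬝ᵥ x = ∑ i, ∑ j, adjOf ω i j * y i ^ 2 := by
    refine Finset.sum_congr rfl fun i _ => ?_
    rw [← Finset.sum_mul]
    change x i * x i = deg ω i * y i ^ 2
    have h3 := Real.sq_sqrt (hdeg i).le
    have h4 : √(deg ω i) ≠ 0 := Real.sqrt_ne_zero'.2 (hdeg i)
    rw [hy, mul_pow, inv_pow, h3]
    have := (hdeg i).ne'
    field_simp
  have h2 : x ⬝ᵥ x = ∑ i, ∑ j, adjOf ω i j * y j ^ 2 := by
    rw [h1, Finset.sum_comm]
    refine Finset.sum_congr rfl fun i _ => Finset.sum_congr rfl fun j _ => ?_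
    rw [(isSymm_adjOf ω).apply]
  have h3 : y ⬝ᵥ adjOf ω *ᵥ y = ∑ i, ∑ j, adjOf ω i j * (y i * y j) := by
    simp only [dotProduct, mulVec, Finset.mul_sum]
    refine Finset.sum_congr rfl fun i _ => Finset.sum_congr rfl fun j _ => ?_
    ring
  have h4 : ∑ i, ∑ j, adjOf ω i j * (y i - y j) ^ 2 =
      ∑ i, ∑ j, adjOf ω i j * y i ^ 2 + ∑ i, ∑ j, adjOf ω i j * y j ^ 2 -
        2 * ∑ i, ∑ j, adjOf ω i j * (y i * y j) := by
    simp only [Finset.mul_sum, ← Finset.sum_add_distrib, ← Finset.sum_sub_distrib]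
    refine Finset.sum_congr rfl fun i _ => Finset.sum_congr rfl fun j _ => ?_
    ring
  change _ = 1 / 2 * ∑ i, ∑ j, adjOf ω i j * (y i - y j) ^ 2
  rw [h4, ← h1, ← h2, h3]
  ring

lemma dotProduct_normAdj_le (hdeg : ∀ i, 0 < deg ω i) (x : Fin m → ℝ) :
    x ⬝ᵥ normAdj ω *ᵥ x ≤ x ⬝ᵥ x := by
  have h : 0 ≤ ∑ i, ∑ j, adjOf ω i j *
      ((√(deg ω i))⁻¹ * x i - (√(deg ω j))⁻¹ * x j) ^ 2 :=
    Finset.sum_nonneg fun i _ => Finset.sum_nonneg fun j _ =>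
      mul_nonneg (adjOf_nonneg ω i j) (sq_nonneg _)
  linarith [dotProduct_sub_normAdj hdeg x]

lemma exists_eq_smul_of_normAdj_mulVec_eq (hdeg : ∀ i, 0 < deg ω i)
    (hconn : ∀ u : Fin m → ℝ, (∀ i j, adjOf ω i j ≠ 0 → u i = u j) → ∀ i j, u i = u j)
    {x : Fin m → ℝ} (hx : normAdj ω *ᵥ x = x) : ∃ c : ℝ, x = c • fun i => √(deg ω i) := by
  have h := dotProduct_sub_normAdj hdeg x
  rw [hx, sub_self] at h
  have hnn (i j) : 0 ≤ adjOf ω i j * ((√(deg ω i))⁻¹ * x i - (√(deg ω j))⁻¹ * x j) ^ 2 :=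
    mul_nonneg (adjOf_nonneg ω i j) (sq_nonneg _)
  have h0 : ∑ i, ∑ j, adjOf ω i j * ((√(deg ω i))⁻¹ * x i - (√(deg ω j))⁻¹ * x j) ^ 2 = 0 := by
    linarith
  have hedge : ∀ i j, adjOf ω i j ≠ 0 → (√(deg ω i))⁻¹ * x i = (√(deg ω j))⁻¹ * x j := by
    intro i j hij
    have h1 := (Finset.sum_eq_zero_iff_of_nonneg
      fun i _ => Finset.sum_nonneg fun j _ => hnn i j).1 h0 i (Finset.mem_univ i)
    have h2 := (Finset.sum_eq_zero_iff_of_nonneg fun j _ => hnn i j).1 h1 j (Finset.mem_univ j)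
    have h3 := (mul_eq_zero.1 h2).resolve_left hij
    exact sub_eq_zero.1 (pow_eq_zero_iff two_ne_zero |>.1 h3)
  have hconst := hconn _ hedge
  rcases isEmpty_or_nonempty (Fin m) with hm | ⟨⟨i0⟩⟩
  · exact ⟨0, funext fun i => hm.elim i⟩
  · refine ⟨(√(deg ω i0))⁻¹ * x i0, funext fun i => ?_⟩
    have h4 : √(deg ω i) ≠ 0 := Real.sqrt_ne_zero'.2 (hdeg i)
    rw [Pi.smul_apply, smul_eq_mul, ← hconst i i0]
    field_simp

end NormAdj

end

section

open ProbabilityTheory Finset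

section Mean

variable {n : ℕ}

lemma chi_sq (i : Fin (2 * n)) : chi n i ^ 2 = 1 := by
  rw [chi]; split_ifs <;> norm_num

lemma sum_chi : ∑ i, chi n i = 0 := by
  have h := Fin.sum_univ_eq_sum_range (fun i => if i < n then (1 : ℝ) else -1) (2 * n)
  rw [two_mul, Finset.sum_range_add] at h
  rw [show (∑ i, chi n i) = ∑ i : Fin (2 * n), if (i : ℕ) < n then (1 : ℝ) else -1 from rfl]
  rw [← two_mul] at h
  rw [h, Finset.sum_congr rfl fun x hx => if_pos (Finset.mem_range.1 hx),
    Finset.sum_congr (s₁ := range n) rfl fun x _ => if_neg (by lia : ¬ n + x < n)]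
  simp

lemma Bmat_apply (hn : 1 ≤ n) (a b : ℝ) (i j : Fin (2 * n)) :
    Bmat n a b i j = (a + b) / (2 * n) + (a - b) / (2 * n) * (chi n i * chi n j) := by
  have hn0 : (n : ℝ) ≠ 0 := by positivity
  rw [Bmat, Matrix.of_apply, chi, chi]
  by_cases h1 : i.val < n <;> by_cases h2 : j.val < n <;> simp [h1, h2] <;> field_simp <;> ring

lemma dotProduct_Bmat_mulVec (hn : 1 ≤ n) (a b : ℝ) (x y : Fin (2 * n) → ℝ) :
    x ⬝ᵥ Bmat n a b *ᵥ y = (a + b) / (2 * n) * ((∑ i, x i) * ∑ i, y i) +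
      (a - b) / (2 * n) * ((chi n ⬝ᵥ x) * (chi n ⬝ᵥ y)) := by
  simp only [dotProduct, mulVec, Bmat_apply hn]
  rw [Finset.sum_mul_sum, Finset.sum_mul_sum, Finset.mul_sum, Finset.mul_sum,
    ← Finset.sum_add_distrib]
  refine Finset.sum_congr rfl fun i _ => ?_
  rw [Finset.mul_sum, Finset.mul_sum, Finset.mul_sum, ← Finset.sum_add_distrib]
  refine Finset.sum_congr rfl fun j _ => ?_
  ring

lemma sum_Bmat (hn : 1 ≤ n) (a b : ℝ) (i : Fin (2 * n)) : ∑ j, Bmat n a b i j = a + b := by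
  have hn0 : (n : ℝ) ≠ 0 := by positivity
  simp only [Bmat_apply hn, Finset.sum_add_distrib, ← Finset.mul_sum, sum_chi]
  simp only [sum_const, card_univ, Fintype.card_fin, nsmul_eq_mul]
  push_cast
  field_simp
  ring

end Mean

section Deterministic

variable {n : ℕ} {ω : Fin (2 * n) → Fin (2 * n) → Bool} {a b K r q : ℝ}
  (hn : 1 ≤ n) (hr : 0 < r) (hd : a + b = r ^ 2) (hK : 0 < K) (hq : 0 < q)
  (hqn : q ^ 2 = 2 * n) (hX : specNorm (adjOf ω - Bmat n a b) ≤ K * r)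
  (hdeg : ∀ i, r ^ 2 / 8 ≤ deg ω i)

include hqn in
lemma l2_one_le (hq : 0 < q) : l2 (fun _ : Fin (2 * n) => (1 : ℝ)) ≤ q := by
  refine l2_le_of_sum_sq_le hq.le ?_
  simp [hqn]

include hn hr hd hK hq hqn hX in
lemma l2_deg_sub_le : l2 (fun i => deg ω i - r ^ 2) ≤ K * r * q := by
  have h : (fun i => deg ω i - r ^ 2) = (adjOf ω - Bmat n a b) *ᵥ fun _ => 1 := by
    funext i
    simp only [mulVec, dotProduct, Matrix.sub_apply, mul_one, Finset.sum_sub_distrib,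
      sum_Bmat hn, hd, deg]
  rw [h]
  refine (l2_mulVec_le _ _).trans ?_
  have h1 := l2_one_le hqn hq
  have h2 := l2_nonneg (fun _ : Fin (2 * n) => (1 : ℝ))
  gcongr

include hr hdeg

omit hn in
lemma inv_sqrt_deg_sq_le (i : Fin (2 * n)) : (√(deg ω i))⁻¹ ^ 2 ≤ (3 / r) ^ 2 := by
  have h := hdeg i
  have hD : 0 < deg ω i := lt_of_lt_of_le (by positivity) h
  rw [inv_pow, Real.sq_sqrt hD.le, div_pow, inv_le_comm₀ hD (by positivity), inv_div]
  linarith [sq_nonneg r]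

lemma l2_inv_sqrt_deg_mul_le (u : Fin (2 * n) → ℝ) :
    l2 (fun i => (√(deg ω i))⁻¹ * u i) ≤ 3 / r * l2 u :=
  l2_mul_le (by positivity) (inv_sqrt_deg_sq_le hr hdeg)

include hqn hq in
lemma abs_sum_inv_sqrt_deg_mul_le {f : Fin (2 * n) → ℝ} (hf : ∀ i, f i ^ 2 = 1)
    (u : Fin (2 * n) → ℝ) : |f ⬝ᵥ fun i => (√(deg ω i))⁻¹ * u i| ≤ 3 / r * q * l2 u := by
  have h1 := abs_dotProduct_le f fun i => (√(deg ω i))⁻¹ * u i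
  have h2 : l2 f ≤ q := by
    refine l2_le_of_sum_sq_le hq.le ?_
    simp [hf, hqn]
  have h3 := l2_inv_sqrt_deg_mul_le hr hdeg u
  calc _ ≤ _ := h1
    _ ≤ q * (3 / r * l2 u) := by
      gcongr
      exact l2_nonneg _
    _ = _ := by ring

include hn hd hK hqn hq hX

/-- The quadratic form of the normalized adjacency matrix is close to that of the rank one
perturbation carrying the community structure. -/
lemma abs_dotProduct_normAdj_sub_le {w : Fin (2 * n) → ℝ}
    (hw : w ⬝ᵥ (fun i => √(deg ω i)) = 0) (u : Fin (2 * n) → ℝ) :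
    |u ⬝ᵥ normAdj ω *ᵥ w - (a - b) / (2 * n) *
      ((chi n ⬝ᵥ fun i => (√(deg ω i))⁻¹ * u i) * (chi n ⬝ᵥ fun i => (√(deg ω i))⁻¹ * w i))| ≤
      18 * K / r * (l2 u * l2 w) := by
  have hD : ∀ i, 0 < deg ω i := fun i => lt_of_lt_of_le (by positivity) (hdeg i)
  have hn0 : (0 : ℝ) < n := by exact_mod_cast hn
  set gu : Fin (2 * n) → ℝ := fun i => (√(deg ω i))⁻¹ * u i with hgu
  set gw : Fin (2 * n) → ℝ := fun i => (√(deg ω i))⁻¹ * w i with hgw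
  have hlu := l2_nonneg u
  have hlw := l2_nonneg w
  have hgu_le : l2 gu ≤ 3 / r * l2 u := l2_inv_sqrt_deg_mul_le hr hdeg u
  have hgw_le : l2 gw ≤ 3 / r * l2 w := l2_inv_sqrt_deg_mul_le hr hdeg w
  have hsumu : |∑ i, gu i| ≤ 3 / r * q * l2 u := by
    have := abs_sum_inv_sqrt_deg_mul_le hr hq hqn hdeg (f := fun _ => 1) (by simp) u
    simpa [dotProduct] using this
  have hsumw : |∑ i, gw i| ≤ 3 * K * q / r ^ 2 * l2 w := by
    have h1 : ∑ i, gw i = -((fun i => deg ω i - r ^ 2) ⬝ᵥ gw) / r ^ 2 := by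
      have h2 : (fun i => deg ω i - r ^ 2) ⬝ᵥ gw =
          w ⬝ᵥ (fun i => √(deg ω i)) - r ^ 2 * ∑ i, gw i := by
        simp only [dotProduct, Finset.mul_sum, ← Finset.sum_sub_distrib]
        refine Finset.sum_congr rfl fun i _ => ?_
        have h3 := Real.mul_self_sqrt (hD i).le
        have h4 : √(deg ω i) ≠ 0 := Real.sqrt_ne_zero'.2 (hD i)
        simp only [hgw]
        field_simp
        linear_combination -(w i) * h3
      rw [h2, hw]
      field_simp
      ring
    have h3 := abs_dotProduct_le (fun i => deg ω i - r ^ 2) gw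
    have h4 := l2_deg_sub_le hn hr hd hK hq hqn hX
    rw [h1, abs_div, abs_neg, abs_of_pos (by positivity : 0 < r ^ 2), div_le_iff₀ (by positivity)]
    calc _ ≤ _ := h3
      _ ≤ K * r * q * (3 / r * l2 w) := by
        gcongr
        exact l2_nonneg _
      _ = _ := by field_simp
  have hsplit : u ⬝ᵥ normAdj ω *ᵥ w - (a - b) / (2 * n) * ((chi n ⬝ᵥ gu) * (chi n ⬝ᵥ gw)) =
      gu ⬝ᵥ (adjOf ω - Bmat n a b) *ᵥ gw + r ^ 2 / (2 * n) * ((∑ i, gu i) * ∑ i, gw i) := by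
    rw [dotProduct_normAdj_mulVec, sub_mulVec, dotProduct_sub, dotProduct_Bmat_mulVec hn, hd]
    ring
  rw [hsplit]
  refine (abs_add_le _ _).trans ?_
  have hT1 : |gu ⬝ᵥ (adjOf ω - Bmat n a b) *ᵥ gw| ≤ 9 * K / r * (l2 u * l2 w) := by
    calc _ ≤ _ := abs_dotProduct_mulVec_le _ _ _
      _ ≤ K * r * (3 / r * l2 u * (3 / r * l2 w)) := by
        have := l2_nonneg gu
        have := l2_nonneg gw
        gcongr
      _ = _ := by field_simp; ring
  have hT2 : |r ^ 2 / (2 * n) * ((∑ i, gu i) * ∑ i, gw i)| ≤ 9 * K / r * (l2 u * l2 w) := by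
    rw [abs_mul, abs_mul, ← hqn, abs_of_pos (by positivity : 0 < r ^ 2 / q ^ 2)]
    calc _ ≤ r ^ 2 / q ^ 2 * (3 / r * q * l2 u * (3 * K * q / r ^ 2 * l2 w)) := by gcongr
      _ = _ := by field_simp; ring
  calc _ ≤ _ := add_le_add hT1 hT2
    _ = _ := by ring

lemma abs_chi_dotProduct_le {u : Fin (2 * n) → ℝ} (hu : u ⬝ᵥ chi n = 0) :
    |chi n ⬝ᵥ fun i => (√(deg ω i))⁻¹ * u i| ≤ 3 * K * q / r ^ 2 * l2 u := by
  have hD : ∀ i, 0 < deg ω i := fun i => lt_of_lt_of_le (by positivity) (hdeg i)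
  set f : Fin (2 * n) → ℝ := fun i => chi n i * ((√(deg ω i))⁻¹ - r⁻¹) with hf
  have h1 : (chi n ⬝ᵥ fun i => (√(deg ω i))⁻¹ * u i) = f ⬝ᵥ u := by
    have : f ⬝ᵥ u = (chi n ⬝ᵥ fun i => (√(deg ω i))⁻¹ * u i) - r⁻¹ * (u ⬝ᵥ chi n) := by
      simp only [dotProduct, Finset.mul_sum, ← Finset.sum_sub_distrib, hf]
      refine Finset.sum_congr rfl fun i _ => ?_
      ring
    rw [this, hu]
    ring
  have h2 : l2 f ≤ 3 / r ^ 3 * (K * r * q) := by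
    have h3 : ∀ i, f i = (-chi n i * (√(deg ω i))⁻¹ / (r * (r + √(deg ω i)))) *
        (deg ω i - r ^ 2) := by
      intro i
      have h4 : 0 < √(deg ω i) := Real.sqrt_pos.2 (hD i)
      have h5 := Real.sq_sqrt (hD i).le
      have h6 : r + √(deg ω i) ≠ 0 := by positivity
      have : deg ω i - r ^ 2 = (√(deg ω i) - r) * (r + √(deg ω i)) := by linear_combination -h5
      rw [this]
      simp only [hf]
      field_simp
      ring
    have h7 : f = fun i => (-chi n i * (√(deg ω i))⁻¹ / (r * (r + √(deg ω i)))) *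
        (deg ω i - r ^ 2) := funext h3
    rw [h7]
    refine (l2_mul_le (K := 3 / r ^ 3) (by positivity) fun i => ?_).trans ?_
    · have h4 : 0 < √(deg ω i) := Real.sqrt_pos.2 (hD i)
      rw [div_pow, mul_pow, neg_sq, chi_sq, one_mul]
      calc _ ≤ (3 / r) ^ 2 / (r * r) ^ 2 := by
            have := inv_sqrt_deg_sq_le hr hdeg i
            gcongr
            linarith
        _ = _ := by field_simp
    · have := l2_deg_sub_le hn hr hd hK hq hqn hX
      gcongr
  rw [h1]
  refine (abs_dotProduct_le _ _).trans ?_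
  calc _ ≤ 3 / r ^ 3 * (K * r * q) * l2 u := by
        have := l2_nonneg u
        gcongr
    _ = _ := by field_simp

lemma abs_dotProduct_normAdj_le (hab : 0 ≤ a - b) (hb : 0 ≤ b) {w u : Fin (2 * n) → ℝ}
    (hw : w ⬝ᵥ (fun i => √(deg ω i)) = 0) (hu : u ⬝ᵥ chi n = 0) :
    |u ⬝ᵥ normAdj ω *ᵥ w| ≤ 27 * K / r * (l2 u * l2 w) := by
  have h1 := abs_dotProduct_normAdj_sub_le hn hr hd hK hq hqn hX hdeg hw u
  have h2 := abs_chi_dotProduct_le hn hr hd hK hq hqn hX hdeg hu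
  have h3 := abs_sum_inv_sqrt_deg_mul_le hr hq hqn hdeg (f := chi n) chi_sq w
  set T := (a - b) / (2 * n) *
      ((chi n ⬝ᵥ fun i => (√(deg ω i))⁻¹ * u i) * (chi n ⬝ᵥ fun i => (√(deg ω i))⁻¹ * w i))
  have hT : |T| ≤ 9 * K / r * (l2 u * l2 w) := by
    rw [abs_mul, abs_mul, ← hqn, abs_of_nonneg (by positivity : 0 ≤ (a - b) / q ^ 2)]
    have hlu := l2_nonneg u
    have hlw := l2_nonneg w
    calc _ ≤ r ^ 2 / q ^ 2 * (3 * K * q / r ^ 2 * l2 u * (3 / r * q * l2 w)) := by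
          gcongr
          linarith
      _ = _ := by field_simp; ring
  calc _ = |(u ⬝ᵥ normAdj ω *ᵥ w - T) + T| := by rw [sub_add_cancel]
    _ ≤ _ := abs_add_le _ _
    _ ≤ _ := add_le_add h1 hT
    _ = _ := by ring

omit hdeg in
lemma abs_sum_deg_sub_le (hKr : 8 * K ≤ r) :
    |∑ i, deg ω i - r ^ 2 * (2 * n)| ≤ r ^ 2 * (2 * n) / 8 := by
  have hδ := l2_deg_sub_le hn hr hd hK hq hqn hX
  have h1 := abs_dotProduct_le (fun i => deg ω i - r ^ 2) fun _ => 1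
  have h2 : (fun i => deg ω i - r ^ 2) ⬝ᵥ (fun _ => 1) = ∑ i, deg ω i - r ^ 2 * (2 * n) := by
    simp only [dotProduct, mul_one, Finset.sum_sub_distrib, sum_const, card_univ,
      Fintype.card_fin, nsmul_eq_mul]
    push_cast
    ring
  rw [h2] at h1
  have h3 := l2_one_le hqn hq
  calc _ ≤ _ := h1
    _ ≤ K * r * q * q := by
      gcongr
      exact l2_nonneg _
    _ = K * (r * q ^ 2) := by ring
    _ ≤ r / 8 * (r * q ^ 2) := by
      gcongr
      linarith
    _ = _ := by rw [hqn]; ring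

lemma chi_dotProduct_sqrt_deg_sq_le (hKr : 8 * K ≤ r) :
    (chi n ⬝ᵥ fun i => √(deg ω i)) ^ 2 ≤ n ^ 2 * r ^ 2 := by
  have hD : ∀ i, 0 < deg ω i := fun i => lt_of_lt_of_le (by positivity) (hdeg i)
  have hn0 : (0 : ℝ) < n := by exact_mod_cast hn
  have hδ := l2_deg_sub_le hn hr hd hK hq hqn hX
  set s : Fin (2 * n) → ℝ := fun i => √(deg ω i) with hs
  have hspos : ∀ i, 0 < s i := fun i => Real.sqrt_pos.2 (hD i)
  have hs_sq : ∀ i, s i ^ 2 = deg ω i := fun i => Real.sq_sqrt (hD i).le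
  have h1 : chi n ⬝ᵥ s = (fun i => chi n i / (r + s i)) ⬝ᵥ fun i => deg ω i - r ^ 2 := by
    have h2 : (fun i => chi n i / (r + s i)) ⬝ᵥ (fun i => deg ω i - r ^ 2) =
        chi n ⬝ᵥ s - r * ∑ i, chi n i := by
      simp only [dotProduct, Finset.mul_sum, ← Finset.sum_sub_distrib]
      refine Finset.sum_congr rfl fun i _ => ?_
      have h3 : r + s i ≠ 0 := (add_pos hr (hspos i)).ne'
      rw [← hs_sq]
      field_simp
      ring
    rw [h2, sum_chi]
    ring
  have h4 : l2 (fun i => chi n i / (r + s i)) ≤ q / r := by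
    refine l2_le_of_sum_sq_le (by positivity) ?_
    calc _ ≤ ∑ i : Fin (2 * n), 1 / r ^ 2 := by
          refine Finset.sum_le_sum fun i _ => ?_
          have := hspos i
          rw [div_pow, chi_sq]
          gcongr
          linarith
      _ = _ := by
          simp only [sum_const, card_univ, Fintype.card_fin, nsmul_eq_mul]
          rw [div_pow, hqn]
          push_cast
          ring
  have h5 : |chi n ⬝ᵥ s| ≤ n * r := by
    rw [h1]
    calc _ ≤ _ := abs_dotProduct_le _ _
      _ ≤ q / r * (K * r * q) := by
        gcongr
        exact l2_nonneg _
      _ = K * q ^ 2 := by field_simp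
      _ ≤ _ := by rw [hqn]; nlinarith
  rw [← sq_abs, ← mul_pow]
  exact pow_le_pow_left₀ (abs_nonneg _) h5 2

lemma div_le_sum_inv_sqrt_deg (hKr : 8 * K ≤ r) : n / r ≤ ∑ i, (√(deg ω i))⁻¹ := by
  have hD : ∀ i, 0 < deg ω i := fun i => lt_of_lt_of_le (by positivity) (hdeg i)
  have hn0 : (0 : ℝ) < n := by exact_mod_cast hn
  have hsum2 := (abs_le.1 (abs_sum_deg_sub_le hn hr hd hK hq hqn hX hKr)).2
  have hrn : 0 < r ^ 2 * n := by positivity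
  have h1 : ∀ i, 3 / (2 * r) - deg ω i / (2 * r ^ 3) ≤ (√(deg ω i))⁻¹ := by
    intro i
    have h2 := Real.sqrt_pos.2 (hD i)
    have h4 := Real.sq_sqrt (hD i).le
    set t := √(deg ω i)
    rw [← h4, ← sub_nonneg]
    have h3 : t⁻¹ - (3 / (2 * r) - t ^ 2 / (2 * r ^ 3)) =
        (r - t) ^ 2 * (2 * r + t) / (2 * r ^ 3 * t) := by
      field_simp
      ring
    rw [h3]
    positivity
  refine le_trans ?_ (Finset.sum_le_sum fun i _ => h1 i)
  rw [Finset.sum_sub_distrib, ← Finset.sum_div univ (fun i => deg ω i)]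
  simp only [sum_const, card_univ, Fintype.card_fin, nsmul_eq_mul]
  push_cast
  have h4 : (∑ i, deg ω i) / (2 * r ^ 3) ≤ 2 * (r ^ 2 * (2 * n)) / (2 * r ^ 3) := by
    gcongr
    linarith
  have h5 : 2 * (r ^ 2 * (2 * n)) / (2 * r ^ 3) = 2 * (n / r) := by field_simp
  have h6 : 2 * (n : ℝ) * (3 / (2 * r)) = 3 * (n / r) := by field_simp
  linarith

/-- A test vector orthogonal to the top eigenvector with large Rayleigh quotient. -/
lemma exists_test_vector (hKr : 8 * K ≤ r) (hab : 144 * K * r ≤ a - b) :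
    ∃ y : Fin (2 * n) → ℝ, y ⬝ᵥ (fun i => √(deg ω i)) = 0 ∧ 0 < y ⬝ᵥ y ∧
      (a - b) / (8 * r ^ 2) * (y ⬝ᵥ y) ≤ y ⬝ᵥ normAdj ω *ᵥ y := by
  have hD : ∀ i, 0 < deg ω i := fun i => lt_of_lt_of_le (by positivity) (hdeg i)
  have hn0 : (0 : ℝ) < n := by exact_mod_cast hn
  have hsum1 := (abs_le.1 (abs_sum_deg_sub_le hn hr hd hK hq hqn hX hKr)).1
  have hchis := chi_dotProduct_sqrt_deg_sq_le hn hr hd hK hq hqn hX hdeg hKr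
  have hginv := div_le_sum_inv_sqrt_deg hn hr hd hK hq hqn hX hdeg hKr
  have hmain := fun y hy => abs_dotProduct_normAdj_sub_le hn hr hd hK hq hqn hX hdeg (w := y) hy y
  set s : Fin (2 * n) → ℝ := fun i => √(deg ω i) with hs
  have hspos : ∀ i, 0 < s i := fun i => Real.sqrt_pos.2 (hD i)
  have hss : s ⬝ᵥ s = ∑ i, deg ω i :=
    Finset.sum_congr rfl fun i _ => Real.mul_self_sqrt (hD i).le
  have hrn : 0 < r ^ 2 * n := by positivity
  have hsspos : 0 < s ⬝ᵥ s := by rw [hss]; linarith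
  set κ := (chi n ⬝ᵥ s) / (s ⬝ᵥ s) with hκ
  have hκs : κ * (s ⬝ᵥ s) = chi n ⬝ᵥ s := div_mul_cancel₀ _ hsspos.ne'
  obtain ⟨y, hy⟩ : ∃ y : Fin (2 * n) → ℝ, y = chi n - κ • s := ⟨_, rfl⟩
  have hys : y ⬝ᵥ s = 0 := by
    rw [hy, sub_dotProduct, smul_dotProduct, smul_eq_mul, hκs, sub_self]
  have hchi2 : chi n ⬝ᵥ chi n = 2 * n := by
    simp only [dotProduct, ← sq, chi_sq, sum_const, card_univ, Fintype.card_fin, nsmul_eq_mul]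
    push_cast
    ring
  have hyy : y ⬝ᵥ y = 2 * n - κ * (chi n ⬝ᵥ s) := by
    have : y ⬝ᵥ y = y ⬝ᵥ chi n := by
      conv_lhs => rw [hy, dotProduct_sub, ← hy, dotProduct_smul, hys, smul_zero, sub_zero]
    rw [this, dotProduct_comm, hy, dotProduct_sub, dotProduct_smul, hchi2, smul_eq_mul]
  have hκnn : 0 ≤ κ * (chi n ⬝ᵥ s) := by
    rw [hκ, div_mul_eq_mul_div]
    exact div_nonneg (mul_self_nonneg _) hsspos.le
  have hκle : κ * (chi n ⬝ᵥ s) ≤ n := by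
    rw [hκ, div_mul_eq_mul_div, ← sq, div_le_iff₀ hsspos, hss]
    nlinarith
  have hyy2 : y ⬝ᵥ y ≤ 2 * n := by linarith
  have hyypos : 0 < y ⬝ᵥ y := by linarith
  have hgy : (chi n ⬝ᵥ fun i => (√(deg ω i))⁻¹ * y i) = ∑ i, (√(deg ω i))⁻¹ := by
    have h1 : ∀ i, chi n i * ((√(deg ω i))⁻¹ * y i) = (√(deg ω i))⁻¹ - κ * chi n i := by
      intro i
      have h2 := chi_sq i
      have h3 := (hspos i).ne'
      rw [hy]
      change chi n i * ((s i)⁻¹ * (chi n i - κ * s i)) = (s i)⁻¹ - κ * chi n i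
      field_simp
      linear_combination h2
    rw [dotProduct, Finset.sum_congr rfl fun i _ => h1 i, Finset.sum_sub_distrib,
      ← Finset.mul_sum, sum_chi]
    ring
  refine ⟨y, hys, hyypos, ?_⟩
  have hmain1 := (abs_le.1 (hmain y hys)).1
  rw [hgy, ← sq (l2 y), ← dotProduct_self_eq] at hmain1
  have hab0 : 0 ≤ a - b := le_trans (by positivity) hab
  have hT : (a - b) / (4 * r ^ 2) * (y ⬝ᵥ y) ≤
      (a - b) / (2 * n) * ((∑ i, (√(deg ω i))⁻¹) * ∑ i, (√(deg ω i))⁻¹) := by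
    calc _ ≤ (a - b) / (4 * r ^ 2) * (2 * n) := by gcongr
      _ = (a - b) / (2 * n) * (n / r * (n / r)) := by field_simp; ring
      _ ≤ _ := by gcongr
  have hsmall : 18 * K / r ≤ (a - b) / (8 * r ^ 2) := by
    rw [div_le_div_iff₀ hr (by positivity)]
    nlinarith
  have h8 : (a - b) / (4 * r ^ 2) = 2 * ((a - b) / (8 * r ^ 2)) := by field_simp; ring
  rw [h8] at hT
  have h9 := mul_le_mul_of_nonneg_right hsmall hyypos.le
  linarith

/-- On the event that the adjacency matrix is close to its mean, that all degrees are large and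
that the graph is connected, the second eigenvector is close to the community indicator. -/
lemma sum_sq_sub_chi_le (hKr : 8 * K ≤ r) (hb : 0 ≤ b) (hab : 144 * K * r ≤ a - b)
    (hconn : ∀ u : Fin (2 * n) → ℝ, (∀ i j, adjOf ω i j ≠ 0 → u i = u j) → ∀ i j, u i = u j)
    (hH : (normAdj ω).IsHermitian) {lam : Fin (2 * n) → ℝ} {σ : Equiv.Perm (Fin (2 * n))}
    (hlam : lam = hH.eigenvalues ∘ σ) (hanti : Antitone lam) {i : Fin (2 * n)} (hi : i.val = 1)
    {w : Fin (2 * n) → ℝ} (hw : normAdj ω *ᵥ w = lam i • w) (hw1 : ∑ j, w j ^ 2 = 1)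
    (hwchi : 0 ≤ ∑ j, w j * chi n j) :
    ∑ j, (w j - chi n j / q) ^ 2 ≤ 2 * 216 ^ 2 * K ^ 2 * (a + b) / (a - b) ^ 2 := by
  have hD : ∀ i, 0 < deg ω i := fun i => lt_of_lt_of_le (by positivity) (hdeg i)
  have hs0 : (fun i => √(deg ω i)) ≠ 0 := fun h =>
    (Real.sqrt_pos.2 (hD i)).ne' (congrFun h i)
  obtain ⟨hort, hray⟩ := second_eigenvalue_of_simple_top hH (normAdj_mulVec_sqrt_deg hD) hs0
    (dotProduct_normAdj_le hD) (fun x => exists_eq_smul_of_normAdj_mulVec_eq hD hconn)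
    hlam hanti hi
  have hws := hort w hw
  obtain ⟨y, hys, hypos, hy⟩ := exists_test_vector hn hr hd hK hq hqn hX hdeg hKr hab
  have habpos : 0 < a - b := lt_of_lt_of_le (by positivity) hab
  have hlamge : (a - b) / (8 * r ^ 2) ≤ lam i :=
    le_of_mul_le_mul_right (hy.trans (hray y hys)) hypos
  set c := (∑ j, w j * chi n j) / q with hc
  have hc0 : 0 ≤ c := div_nonneg hwchi hq.le
  have hwchi' : w ⬝ᵥ chi n = c * q := by rw [hc, div_mul_cancel₀ _ hq.ne']; rfl
  have hchi2 : chi n ⬝ᵥ chi n = q ^ 2 := by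
    rw [hqn]
    simp only [dotProduct, ← sq, chi_sq, sum_const, card_univ, Fintype.card_fin, nsmul_eq_mul]
    push_cast
    ring
  have hww : w ⬝ᵥ w = 1 := by rw [← hw1]; simp only [dotProduct, sq]
  have hl2w : l2 w = 1 := by
    have := dotProduct_self_eq w
    rw [hww] at this
    nlinarith [l2_nonneg w]
  set u : Fin (2 * n) → ℝ := w - (c / q) • chi n with hu
  have huchi : u ⬝ᵥ chi n = 0 := by
    rw [hu, sub_dotProduct, smul_dotProduct, hchi2, hwchi', smul_eq_mul]
    field_simp
    ring
  have huw : u ⬝ᵥ w = 1 - c ^ 2 := by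
    rw [hu, sub_dotProduct, smul_dotProduct, hww, dotProduct_comm, hwchi', smul_eq_mul]
    field_simp
  have huu : u ⬝ᵥ u = 1 - c ^ 2 := by
    rw [← huw]
    conv_lhs => rw [hu, dotProduct_sub, ← hu, dotProduct_smul, huchi, smul_zero, sub_zero]
  have hform := abs_dotProduct_normAdj_le hn hr hd hK hq hqn hX hdeg habpos.le hb hws huchi
  rw [hw, dotProduct_smul, huw, ← huu, smul_eq_mul, hl2w, mul_one, dotProduct_self_eq] at hform
  have hlu : l2 u ≤ 216 * K * r / (a - b) := by
    rcases (l2_nonneg u).eq_or_lt with h0 | h0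
    · rw [← h0]; positivity
    have h1 : lam i * l2 u ≤ 27 * K / r := by
      refine le_of_mul_le_mul_right ?_ h0
      calc _ = lam i * l2 u ^ 2 := by ring
        _ ≤ _ := le_abs_self _
        _ ≤ _ := hform
    have h2 : (a - b) / (8 * r ^ 2) * l2 u ≤ 27 * K / r :=
      (mul_le_mul_of_nonneg_right hlamge h0.le).trans h1
    rw [le_div_iff₀ habpos]
    rw [div_mul_eq_mul_div, div_le_div_iff₀ (by positivity) hr] at h2
    have h3 : r * (l2 u * (a - b)) ≤ r * (216 * K * r) := by nlinarith
    exact le_of_mul_le_mul_left h3 hr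
  have hc1 : c ≤ 1 := by
    have : 0 ≤ 1 - c ^ 2 := by rw [← huu, dotProduct_self_eq]; positivity
    nlinarith
  have hdist : ∑ j, (w j - chi n j / q) ^ 2 = 2 - 2 * c := by
    have h1 : ∑ j, (w j - chi n j / q) ^ 2 =
        w ⬝ᵥ w - 2 / q * (w ⬝ᵥ chi n) + 1 / q ^ 2 * (chi n ⬝ᵥ chi n) := by
      simp only [dotProduct, Finset.mul_sum, ← Finset.sum_sub_distrib, ← Finset.sum_add_distrib]
      refine Finset.sum_congr rfl fun j _ => ?_
      field_simp
      ring
    rw [h1, hww, hwchi', hchi2]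
    field_simp
    ring
  have hu2 : l2 u ^ 2 ≤ (216 * K * r / (a - b)) ^ 2 := pow_le_pow_left₀ (l2_nonneg u) hlu 2
  have hfin : 2 * 216 ^ 2 * K ^ 2 * (a + b) / (a - b) ^ 2 = 2 * (216 * K * r / (a - b)) ^ 2 := by
    rw [hd]
    field_simp
  rw [hdist, hfin]
  rw [dotProduct_self_eq] at huu
  nlinarith

end Deterministic

end

section

open ProbabilityTheory Finset

section BlockModel

lemma sbm_eq_edgeMeasure (n : ℕ) (a b : ℝ) :
    sbm n (a / n) (b / n) = edgeMeasure (Bmat n a b) := rfl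

lemma Bmat_comm {n : ℕ} (a b : ℝ) (i j : Fin (2 * n)) : Bmat n a b i j = Bmat n a b j i := by
  simp only [Bmat, Matrix.of_apply, iff_comm]

lemma centeredAdj_Bmat {n : ℕ} (a b : ℝ) (ω : Fin (2 * n) → Fin (2 * n) → Bool) :
    centeredAdj (Bmat n a b) ω = adjOf ω - Bmat n a b := by
  ext i j
  rw [Matrix.sub_apply, adjOf_apply, ← apply_min_max (Bmat_comm a b) i j]
  rfl

/-- The constant in the bound `√(a + b)` for the norm of the noise matrix. -/
noncomputable def noiseConst : ℝ := √(2 * Real.exp 1 * momentConst)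

lemma noiseConst_pos : 0 < noiseConst := by
  have := momentConst_pos
  unfold noiseConst
  positivity

variable {n : ℕ} {a b : ℝ} (hn : 1 ≤ n) (hb : 0 ≤ b) (hba : b ≤ a) (han : a ≤ n)
include hn hb hba han

lemma Bmat_mem_Icc (i j : Fin (2 * n)) : Bmat n a b i j ∈ Set.Icc (0 : ℝ) 1 := by
  have hn0 : (0 : ℝ) < n := by positivity
  rw [Bmat, Matrix.of_apply]
  split_ifs
  · exact ⟨div_nonneg (hb.trans hba) hn0.le, (div_le_one hn0).2 han⟩
  · exact ⟨div_nonneg hb hn0.le, (div_le_one hn0).2 (hba.trans han)⟩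

lemma measure_specNorm_sub_Bmat_le (ha : 1 ≤ a) :
    (edgeMeasure (Bmat n a b)).real
      {ω | noiseConst ^ 2 * (a + b) ≤ specNorm (adjOf ω - Bmat n a b) ^ 2} ≤
        24 * n * Real.exp (-(a + b) / 2) := by
  have hP := Bmat_mem_Icc hn hb hba han
  have := isProbabilityMeasure_edgeMeasure hP
  have hn0 : (0 : ℝ) < n := by positivity
  have hB := momentConst_pos
  obtain ⟨l, hl1, hl2⟩ := exists_nat_pow_near (by linarith : 1 ≤ a + b) one_lt_two
  have hk : (2 : ℝ) ^ (l + 1) ≤ 2 * (a + b) := by rw [pow_succ]; linarith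
  have hPq : ∀ i j, Bmat n a b i j ≤ a / n := fun i j => by
    rw [Bmat, Matrix.of_apply]
    split_ifs
    · exact le_rfl
    · gcongr
  have h := measure_specNorm_centeredAdj_le hP hPq ((div_le_one hn0).2 han) (by lia)
    (by push_cast; field_simp; linarith) (n := l + 1) (by push_cast; field_simp; linarith)
  have hsub : {ω : Fin (2 * n) → Fin (2 * n) → Bool |
      noiseConst ^ 2 * (a + b) ≤ specNorm (adjOf ω - Bmat n a b) ^ 2} ⊆
      {ω | Real.exp 1 * momentConst * 2 ^ (l + 1) ≤
        specNorm (centeredAdj (Bmat n a b) ω) ^ 2} := by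
    intro ω hω
    rw [Set.mem_ofPred_eq] at hω ⊢
    rw [centeredAdj_Bmat]
    refine le_trans ?_ hω
    rw [noiseConst, Real.sq_sqrt (by positivity)]
    calc _ ≤ Real.exp 1 * momentConst * (2 * (a + b)) := by gcongr
      _ = _ := by ring
  refine (measureReal_mono hsub).trans (h.trans ?_)
  set k : ℝ := 2 ^ (l + 1)
  have h1 : k / 2 ≤ Real.exp (k / 2) := by linarith [Real.add_one_le_exp (k / 2)]
  have h2 : Real.exp (-k) = Real.exp (-k / 2) * Real.exp (-k / 2) := by
    rw [← Real.exp_add]; ring_nf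
  have h3 : Real.exp (k / 2) * Real.exp (-k / 2) = 1 := by
    rw [← Real.exp_add]; ring_nf; exact Real.exp_zero
  have h4 : k * Real.exp (-k) ≤ 2 * Real.exp (-k / 2) := by
    rw [h2]
    calc _ = 2 * (k / 2 * Real.exp (-k / 2)) * Real.exp (-k / 2) := by ring
      _ ≤ 2 * (Real.exp (k / 2) * Real.exp (-k / 2)) * Real.exp (-k / 2) := by gcongr
      _ = _ := by rw [h3]; ring
  push_cast
  calc _ = 12 * n * (k * Real.exp (-k)) := by ring
    _ ≤ 12 * n * (2 * Real.exp (-k / 2)) := by gcongr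
    _ ≤ 12 * n * (2 * Real.exp (-(a + b) / 2)) := by gcongr
    _ = _ := by ring

lemma measure_exists_deg_le :
    (edgeMeasure (Bmat n a b)).real {ω | ∃ i, deg ω i ≤ (a + b) / 8} ≤
      2 * n * Real.exp (-(a + b) / 2) := by
  have hP := Bmat_mem_Icc hn hb hba han
  have := isProbabilityMeasure_edgeMeasure hP
  rw [Set.ofPred_exists]
  calc _ ≤ ∑ i : Fin (2 * n), (edgeMeasure (Bmat n a b)).real {ω | deg ω i ≤ (a + b) / 8} :=
        measureReal_iUnion_fintype_le _
    _ ≤ ∑ _i : Fin (2 * n), Real.exp (-(a + b) / 2) := by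
        refine Finset.sum_le_sum fun i _ => ?_
        simpa only [sum_Bmat hn] using measure_deg_le hP (Bmat_comm a b) i
    _ = _ := by simp

/-- The graph is connected outside an event of small probability. -/
lemma measure_disconnected_le (hx1 : n * Real.exp (-(a / 2)) ≤ 1) (hb1 : 1 ≤ b) :
    (edgeMeasure (Bmat n a b)).real
      {ω | ¬∀ u : Fin (2 * n) → ℝ, (∀ i j, adjOf ω i j ≠ 0 → u i = u j) → ∀ i j, u i = u j} ≤
        8 * (n * Real.exp (-(a / 2))) + Real.exp (-n) := by
  have hP := Bmat_mem_Icc hn hb hba han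
  have := isProbabilityMeasure_edgeMeasure hP
  have hn0 : (0 : ℝ) < n := by positivity
  set W₁ : Finset (Fin (2 * n)) := univ.filter fun i => i.val < n with hW₁
  set W₂ : Finset (Fin (2 * n)) := univ.filter fun i => ¬i.val < n with hW₂
  have hc₁ : #W₁ = n := by
    rw [hW₁, Fin.card_filter_val_lt]; lia
  have hc₂ : #W₂ = n := by
    have := Finset.card_filter_add_card_filter_not (s := (univ : Finset (Fin (2 * n))))
      (fun i => i.val < n)
    rw [card_univ, Fintype.card_fin] at this
    lia
  have hdisj : Disjoint W₁ W₂ := Finset.disjoint_filter_filter_not _ _ _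
  have hcut : ∀ W : Finset (Fin (2 * n)), #W = n → (∀ i ∈ W, ∀ j ∈ W, a / n ≤ Bmat n a b i j) →
      (edgeMeasure (Bmat n a b)).real {ω | ∃ S ⊆ W, S.Nonempty ∧ S ≠ W ∧
        ∀ i ∈ S, ∀ j ∈ W \ S, adjOf ω i j = 0} ≤ 4 * (n * Real.exp (-(a / 2))) := by
    intro W hW hle
    have hx : Real.exp (-(a / 2)) = Real.exp (-(a / n * #W / 2)) := by
      rw [hW, div_mul_cancel₀ _ hn0.ne']
    have := measure_exists_cut_le hP (Bmat_comm a b) (div_nonneg (hb.trans hba) hn0.le)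
      hle hx (by rwa [hW])
    rwa [hW] at this
  have h₁ := hcut W₁ hc₁ fun i hi j hj => by
    simp only [hW₁, mem_filter, mem_univ, true_and] at hi hj
    simp [Bmat, hi, hj]
  have h₂ := hcut W₂ hc₂ fun i hi j hj => by
    simp only [hW₂, mem_filter, mem_univ, true_and] at hi hj
    simp [Bmat, hi, hj]
  have h₃ := measure_forall_adjOf_eq_zero_le hP (Bmat_comm a b) hdisj
  have hsum : ∑ i ∈ W₁, ∑ j ∈ W₂, Bmat n a b i j = n * b := by
    have : ∀ i ∈ W₁, ∀ j ∈ W₂, Bmat n a b i j = b / n := fun i hi j hj => by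
      simp only [hW₁, hW₂, mem_filter, mem_univ, true_and] at hi hj
      simp [Bmat, hi, hj]
    rw [Finset.sum_congr rfl fun i hi => Finset.sum_congr rfl (this i hi)]
    simp only [sum_const, hc₁, hc₂, nsmul_eq_mul]
    field_simp
  rw [hsum] at h₃
  have h₃' : Real.exp (-(n * b)) ≤ Real.exp (-n) := by
    gcongr
    exact le_mul_of_one_le_right hn0.le hb1
  refine le_trans (measureReal_mono ?_) ((measureReal_union_le _ _).trans
    (add_le_add ((measureReal_union_le _ _).trans (add_le_add h₁ h₂)) (h₃.trans h₃'))) |>.trans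
    (le_of_eq (by ring))
  intro ω hω
  by_contra hgood
  simp only [Set.mem_union, Set.mem_ofPred_eq, not_or] at hgood
  obtain ⟨⟨hg₁, hg₂⟩, hg₃⟩ := hgood
  push Not at hg₃
  obtain ⟨i₀, hi₀, j₀, hj₀, hadj⟩ := hg₃
  refine hω fun u hu => ?_
  have key : ∀ i, u i = u i₀ := by
    intro i
    by_cases hi : i.val < n
    · exact eq_of_forall_cut hg₁ hu (by simp [hW₁, hi]) hi₀
    · exact (eq_of_forall_cut hg₂ hu (by simpa [hW₂] using hi) hj₀).trans (hu _ _ hadj).symm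
  exact fun i j => (key i).trans (key j).symm

lemma measure_atypical_le (hb1 : 1 ≤ b) (hlog : 5 * Real.log n ≤ a + b) :
    (edgeMeasure (Bmat n a b)).real
      ({ω | noiseConst ^ 2 * (a + b) ≤ specNorm (adjOf ω - Bmat n a b) ^ 2} ∪
        {ω | ∃ i, deg ω i ≤ (a + b) / 8} ∪
        {ω | ¬∀ u : Fin (2 * n) → ℝ, (∀ i j, adjOf ω i j ≠ 0 → u i = u j) →
          ∀ i j, u i = u j}) ≤ 35 * Real.exp (-(Real.log n / 4)) := by
  have hP := Bmat_mem_Icc hn hb hba han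
  have := isProbabilityMeasure_edgeMeasure hP
  have hn0 : (0 : ℝ) < n := by positivity
  have ht0 : 0 ≤ Real.log n := Real.log_nonneg (by exact_mod_cast hn)
  have hexp : (n : ℝ) = Real.exp (Real.log n) := (Real.exp_log hn0).symm
  have htn : Real.log n ≤ n := (Real.log_le_sub_one_of_pos hn0).trans (by linarith)
  set t := Real.log n
  have e₁ : n * Real.exp (-(a + b) / 2) ≤ Real.exp (-(t / 4)) := by
    rw [hexp, ← Real.exp_add]
    gcongr
    linarith
  have e₂ : n * Real.exp (-(a / 2)) ≤ Real.exp (-(t / 4)) := by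
    rw [hexp, ← Real.exp_add]
    gcongr
    linarith
  have e₃ : Real.exp (-(n : ℝ)) ≤ Real.exp (-(t / 4)) := by
    gcongr
    linarith
  have e₄ : Real.exp (-(t / 4)) ≤ 1 := Real.exp_le_one_iff.2 (by linarith)
  have h₁ := measure_specNorm_sub_Bmat_le hn hb hba han (hb1.trans hba)
  have h₂ := measure_exists_deg_le hn hb hba han
  have h₃ := measure_disconnected_le hn hb hba han (e₂.trans e₄) hb1
  refine (measureReal_union_le _ _).trans
    (add_le_add (measureReal_union_le _ _) le_rfl) |>.trans ?_
  linarith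

end BlockModel

end

end StochasticBlockModel

/-- There are constants `C, c > 0` such that for every `ε > 0` and all
sufficiently large `n`: if `a, b ≥ 1`, `d := a + b` satisfies `5·log n < d < n^{1/3-ε}`
and `a - b ≥ C·√d`, then for `G ∼ G_{2n,a/n,b/n}`, with probability at least `1 - n^{-c}`:
any unit eigenvector `w₂` of `N = D^{-1/2} A D^{-1/2}` for the second-largest eigenvalue
`λ₂`, with its sign chosen so that `⟨w₂, χ⟩ ≥ 0`, satisfies
`‖w₂ - χ/√(2n)‖² ≤ C·d/(a-b)²`. -/
theorem stmt17 : ∃ C > (0:ℝ), ∃ c > (0:ℝ), ∀ ε > (0:ℝ), ∃ N0 : ℕ, ∀ n : ℕ, N0 ≤ n →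
    ∀ a b : ℝ, 1 ≤ a → 1 ≤ b → 5 * Real.log n < a + b →
      a + b < (n : ℝ) ^ ((1:ℝ)/3 - ε) →
      C * Real.sqrt (a + b) ≤ a - b →
    ENNReal.ofReal (1 - (n : ℝ) ^ (-c)) ≤
      sbm n (a / n) (b / n)
        {ω | (∀ i, 0 < deg ω i) ∧
          ∀ (hH : (normAdj ω).IsHermitian) (lam : Fin (2*n) → ℝ)
            (σ : Equiv.Perm (Fin (2*n))),
            lam = hH.eigenvalues ∘ σ → Antitone lam →
            ∀ i : Fin (2*n), i.val = 1 →
            ∀ w2 : Fin (2*n) → ℝ,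
              normAdj ω *ᵥ w2 = lam i • w2 → (∑ j, w2 j ^ 2) = 1 →
              0 ≤ ∑ j, w2 j * chi n j →
              ∑ j, (w2 j - chi n j / Real.sqrt (2 * n)) ^ 2
                ≤ C * (a + b) / (a - b) ^ 2} := by
  have hK := StochasticBlockModel.noiseConst_pos
  set K := StochasticBlockModel.noiseConst with hKdef
  refine ⟨2 * 216 ^ 2 * K ^ 2 + 144 * K, by positivity, 1 / 8, by norm_num, fun ε hε =>
    ⟨⌈Real.exp (272 + 64 * K ^ 2)⌉₊, fun n hN a b ha hb hlog hsmall hsep => ?_⟩⟩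
  have hexpn : Real.exp (272 + 64 * K ^ 2) ≤ n := (Nat.le_ceil _).trans (by exact_mod_cast hN)
  have hn0 : (0 : ℝ) < n := (Real.exp_pos _).trans_le hexpn
  have hn : 1 ≤ n := by exact_mod_cast hn0
  have ht : 272 + 64 * K ^ 2 ≤ Real.log n := (Real.le_log_iff_exp_le hn0).2 hexpn
  have hd0 : 0 < a + b := by linarith
  have hr : 0 < √(a + b) := Real.sqrt_pos.2 hd0
  have hr2 : a + b = √(a + b) ^ 2 := (Real.sq_sqrt hd0.le).symm
  have hba : b ≤ a := by
    have : 0 ≤ (2 * 216 ^ 2 * K ^ 2 + 144 * K) * √(a + b) := by positivity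
    linarith
  have han : a ≤ n := by
    have : (n : ℝ) ^ ((1 : ℝ) / 3 - ε) ≤ n := by
      conv_rhs => rw [← Real.rpow_one (n : ℝ)]
      exact Real.rpow_le_rpow_of_exponent_le (by exact_mod_cast hn) (by linarith)
    linarith
  have hP := StochasticBlockModel.Bmat_mem_Icc hn (by linarith) hba han
  have := StochasticBlockModel.isProbabilityMeasure_edgeMeasure hP
  have hbad := StochasticBlockModel.measure_atypical_le hn (by linarith) hba han hb hlog.le
  have hprob : 35 * Real.exp (-(Real.log n / 4)) ≤ (n : ℝ) ^ (-(1 / 8 : ℝ)) := by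
    rw [Real.rpow_def_of_pos hn0]
    have h1 : Real.exp (-(Real.log n / 4)) =
        Real.exp (-(Real.log n / 8)) * Real.exp (Real.log n * -(1 / 8)) := by
      rw [← Real.exp_add]; ring_nf
    have h2 : 35 ≤ Real.exp (Real.log n / 8) := by
      nlinarith [Real.add_one_le_exp (Real.log n / 8)]
    have h3 : Real.exp (Real.log n / 8) * Real.exp (-(Real.log n / 8)) = 1 := by
      rw [← Real.exp_add, add_neg_cancel, Real.exp_zero]
    rw [h1, ← mul_assoc]
    refine mul_le_of_le_one_left (Real.exp_pos _).le ?_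
    rw [← h3]
    gcongr
  have hgood := probReal_compl_eq_one_sub (μ := StochasticBlockModel.edgeMeasure (Bmat n a b))
    (Set.toFinite (_ : Set (Fin (2 * n) → Fin (2 * n) → Bool))).measurableSet |>.ge.trans'
    (sub_le_sub_left (hbad.trans hprob) 1)
  rw [StochasticBlockModel.sbm_eq_edgeMeasure]
  refine (ENNReal.ofReal_le_ofReal hgood).trans ?_
  rw [ofReal_measureReal]
  refine measure_mono fun ω hω => ?_
  simp only [Set.mem_compl_iff, Set.mem_union, Set.mem_ofPred_eq, not_or, not_exists, not_le,
    not_not] at hω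
  obtain ⟨⟨hnoise, hdeg⟩, hconn⟩ := hω
  have hX : specNorm (adjOf ω - Bmat n a b) ≤ K * √(a + b) := by
    refine (lt_of_pow_lt_pow_left₀ 2 (by positivity) ?_).le
    rwa [mul_pow, ← hr2]
  have hKr : 8 * K ≤ √(a + b) := by
    refine Real.le_sqrt_of_sq_le ?_
    nlinarith [sq_nonneg K]
  have hab : 144 * K * √(a + b) ≤ a - b := by
    refine le_trans ?_ hsep
    gcongr
    nlinarith [sq_nonneg K]
  refine ⟨fun i => lt_trans (by positivity) (hdeg i),
    fun hH lam σ hlam hanti i hi w hw hw1 hwchi => ?_⟩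
  refine (StochasticBlockModel.sum_sq_sub_chi_le hn hr hr2 hK (q := √(2 * n)) (by positivity)
    (Real.sq_sqrt (by positivity)) hX (fun i => hr2 ▸ (hdeg i).le) hKr (by linarith) hab hconn hH
    hlam hanti hi hw hw1 hwchi).trans ?_
  gcongr
  linarith
end
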